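/- arXiv:math/0605574 — 4 statements merged into one kernel-verified Lean document; each statement's English description precedes it below -/
import Mathlib

section
/- Assume Soc R = m² and e ≥ 1 + r. For every nonzero finitely generated R-module M with m²M = 0 there exist integers m ≥ n ≥ 0, where possibly m = ∞, such that the Betti sequence of M satisfies: β_{i+1}^R(M) < β_i^R(M) for all 0 ≤ i < n, β_i^R(M) = β_n^R(M) for all n ≤ i ≤ m, and β_{i+1}^R(M) > β_i^R(M) for all i ≥ m. -/
open IsLocalRing CategoryTheory

/-- The length of an `R`-module `M`: the supremum of the lengths of strictly increasing
chains of submodules of `M`.  For a module annihilated by the maximal ideal of a local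
ring this coincides with the dimension over the residue field `k`. -/
noncomputable def moduleLength (R M : Type) [Ring R] [AddCommGroup M] [Module R M] : ℕ∞ :=
  ⨆ p : LTSeries (Submodule R M), (p.length : ℕ∞)

/-- `Ext^n_R(M, N)`, as an object of `ModuleCat R`. -/
noncomputable def extModule (R : Type) [CommRing R] (M N : Type) [AddCommGroup M] [Module R M]
    [AddCommGroup N] [Module R N] (n : ℕ) : ModuleCat R :=
  ((Ext R (ModuleCat R) n).obj (Opposite.op (ModuleCat.of R M))).obj (ModuleCat.of R N)

/-- The `i`-th Betti number `β_i^R(M) = dim_k Ext^i_R(M, k)` of a module `M` over a local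
ring `(R, m, k)`, computed as the length over `R` of `Ext^i_R(M, k)` (an `R`-module
annihilated by `m`, hence a `k`-vector space). -/
noncomputable def bettiNum (R : Type) [CommRing R] [IsLocalRing R] (M : Type) [AddCommGroup M]
    [Module R M] (i : ℕ) : ℕ∞ :=
  moduleLength R (extModule R M (ResidueField R) i).carrier

/-- The `i`-th Bass number `μ^i_R = dim_k Ext^i_R(k, R)` of a local ring `(R, m, k)`. -/
noncomputable def bassNum (R : Type) [CommRing R] [IsLocalRing R] (i : ℕ) : ℕ∞ :=
  moduleLength R (extModule R (ResidueField R) R i).carrier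

/-- The socle `Soc R = (0 :_R m)` of a local ring `(R, m)`. -/
noncomputable def socle (R : Type) [CommRing R] [IsLocalRing R] : Ideal R :=
  Submodule.colon (⊥ : Ideal R) (maximalIdeal R)

/-- The socle dimension `r = dim_k (0 :_R m)` of a local ring `(R, m, k)`. -/
noncomputable def socdim (R : Type) [CommRing R] [IsLocalRing R] : ℕ∞ :=
  moduleLength R (socle R)

/-- The embedding dimension `e = dim_k (m/m²)` of a local ring `(R, m, k)`. -/
noncomputable def embdim (R : Type) [CommRing R] [IsLocalRing R] : ℕ∞ :=
  moduleLength R (CotangentSpace R)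

/-- The residue field `k` is (isomorphic to) a direct summand of the `R`-module `M`,
expressed by a split injection `k → M`. -/
def kSummand (R : Type) [CommRing R] [IsLocalRing R] (M : Type) [AddCommGroup M]
    [Module R M] : Prop :=
  ∃ (f : M →ₗ[R] ResidueField R) (g : ResidueField R →ₗ[R] M), f ∘ₗ g = LinearMap.id

theorem moduleLength_eq (R M : Type) [Ring R] [AddCommGroup M] [Module R M] :
    moduleLength R M = Module.length R M := by
  apply WithBot.coe_injective
  rw [Module.coe_length, Order.krullDim_eq_iSup_length]
  rfl

theorem length_residue (R : Type) [CommRing R] [IsLocalRing R] :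
    Module.length R (R ⧸ maximalIdeal R) = 1 := by
  have : IsSimpleModule R (R ⧸ maximalIdeal R) :=
    isSimpleModule_iff_isCoatom.mpr (maximalIdeal.isMaximal R).out
  exact Module.length_eq_one R _

/-- Existence of minimal free covers over a local ring. -/
theorem exists_min_cover (R : Type) [CommRing R] [IsLocalRing R] (M : Type) [AddCommGroup M]
    [Module R M] [Module.Finite R M] :
    ∃ (b : ℕ) (f : (Fin b → R) →ₗ[R] M), Function.Surjective f ∧
      ∀ x, f x = 0 → ∀ i, x i ∈ maximalIdeal R := by
  classical
  have hex : ∃ (b : ℕ) (f : (Fin b → R) →ₗ[R] M), Function.Surjective f :=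
    Module.Finite.exists_fin' R M
  obtain ⟨f, hf⟩ := Nat.find_spec hex
  have hmin := fun m (hm : m < Nat.find hex) => Nat.find_min hex hm
  revert f hmin
  generalize Nat.find hex = b
  intro f hf hmin
  refine ⟨b, f, hf, ?_⟩
  intro x hx i
  by_contra hi
  have hu : IsUnit (x i) := by
    by_contra h
    exact hi ((mem_maximalIdeal _).2 h)
  obtain ⟨u, hu⟩ := hu
  cases b with
  | zero => exact i.elim0
  | succ c =>
    apply hmin c (Nat.lt_succ_self c)
    let ι : (Fin c → R) →ₗ[R] (Fin (c + 1) → R) :=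
      { toFun := fun y => i.insertNth (α := fun _ => R) 0 y
        map_add' := fun y z => by
          funext j
          refine Fin.succAboveCases i ?_ (fun j => ?_) j <;> simp
        map_smul' := fun a y => by
          funext j
          refine Fin.succAboveCases i ?_ (fun j => ?_) j <;> simp }
    refine ⟨f ∘ₗ ι, ?_⟩
    intro m
    obtain ⟨z, rfl⟩ := hf m
    let w : Fin (c + 1) → R := z - (z i * (↑u⁻¹ : R)) • x
    have hw : w i = 0 := by
      simp [w, ← hu]
    refine ⟨i.removeNth w, ?_⟩
    have : ι (i.removeNth w) = w := by
      have h := Fin.insertNth_self_removeNth i w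
      rw [hw] at h
      exact h
    rw [LinearMap.comp_apply, this]
    simp [w, hx]

/-- The basic length estimate. -/
theorem length_le_of_cover (R : Type) [CommRing R] [IsLocalRing R] {b d : ℕ}
    (K : Submodule R (Fin b → R)) (hK : ∀ x ∈ K, ∀ i, x i ∈ maximalIdeal R)
    (g : (Fin d → R) →ₗ[R] K) (hg : Function.Surjective g) :
    Module.length R K ≤ d + b * Module.length R ↥(maximalIdeal R ^ 2) := by
  let S : Submodule R (Fin b → R) := Submodule.pi Set.univ (fun _ => maximalIdeal R ^ 2)
  let φ : K →ₗ[R] ((Fin b → R) ⧸ S) := S.mkQ ∘ₗ K.subtype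
  have h1 : Module.length R K = Module.length R (LinearMap.ker φ) +
      Module.length R (LinearMap.range φ) :=
    Module.length_eq_add_of_exact (LinearMap.ker φ).subtype φ.rangeRestrict
      (Submodule.subtype_injective _) φ.surjective_rangeRestrict
      (by rw [LinearMap.exact_iff]; simp)
  have h2 : Module.length R (LinearMap.ker φ) ≤ b * Module.length R ↥(maximalIdeal R ^ 2) := by
    have hmem : ∀ x : LinearMap.ker φ, ∀ i, (x : K).1 i ∈ maximalIdeal R ^ 2 := by
      rintro ⟨x, hx⟩ i
      have : x.1 ∈ S := by simpa [φ] using hx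
      exact this i trivial
    let ψ : LinearMap.ker φ →ₗ[R] (Fin b → ↥(maximalIdeal R ^ 2)) :=
      { toFun := fun x i => ⟨(x : K).1 i, hmem x i⟩
        map_add' := fun x y => rfl
        map_smul' := fun c x => rfl }
    have hψ : Function.Injective ψ := by
      intro x y h
      apply Subtype.ext
      apply Subtype.ext
      funext i
      exact congrArg Subtype.val (congrFun h i)
    have := Module.length_le_of_injective (R := R) (N := LinearMap.ker φ)
      (M := Fin b → ↥(maximalIdeal R ^ 2)) ψ hψ
    simpa using this
  have h3 : Module.length R (LinearMap.range φ) ≤ d := by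
    let p : Submodule R (Fin d → R) := Submodule.pi Set.univ (fun _ => maximalIdeal R)
    have hp : p ≤ LinearMap.ker (φ.rangeRestrict ∘ₗ g) := by
      intro x hx
      have : x = ∑ i, x i • (Pi.single i (1 : R) : Fin d → R) := by
        funext j; simp [Finset.sum_apply, Pi.single_apply]
      rw [this]
      refine Submodule.sum_mem _ fun i _ => ?_
      rw [LinearMap.mem_ker]
      apply Subtype.ext
      simp only [map_smul, LinearMap.comp_apply, φ]
      change S.mkQ (x i • (g (Pi.single i 1)).1) = 0
      rw [Submodule.mkQ_apply, Submodule.Quotient.mk_eq_zero]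
      intro j _
      rw [pow_two]
      exact Ideal.mul_mem_mul (hx i trivial) (hK _ (g (Pi.single i 1)).2 j)
    have := Module.length_le_of_surjective (p.liftQ _ hp) (by
      intro y
      obtain ⟨x, hx⟩ := (φ.surjective_rangeRestrict.comp hg) y
      exact ⟨p.mkQ x, hx⟩)
    refine this.trans ?_
    rw [(Submodule.quotientPi (fun _ : Fin d => maximalIdeal R)).length_eq]
    simp [length_residue]
  rw [h1, add_comm]
  exact add_le_add h3 h2

theorem length_ring (R : Type) [CommRing R] [IsLocalRing R] :
    Module.length R R = 1 + embdim R + Module.length R ↥(maximalIdeal R ^ 2) := by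
  have h1 : Module.length R R = Module.length R (maximalIdeal R) +
      Module.length R (R ⧸ maximalIdeal R) :=
    Module.length_eq_add_of_exact (maximalIdeal R).subtype (maximalIdeal R).mkQ
      (Submodule.subtype_injective _) (Submodule.mkQ_surjective _)
      (by rw [LinearMap.exact_iff]; simp)
  have h2 : Module.length R (maximalIdeal R) = Module.length R ↥(maximalIdeal R ^ 2) +
      Module.length R (CotangentSpace R) :=
    Module.length_eq_add_of_exact (Submodule.inclusion (Ideal.pow_le_self two_ne_zero))
      (maximalIdeal R).toCotangent
      (Submodule.inclusion_injective _) (Ideal.toCotangent_surjective _)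
      (by
        rw [LinearMap.exact_iff]
        ext x
        rw [Ideal.mem_toCotangent_ker, Submodule.range_inclusion]
        simp)
  rw [h1, h2, length_residue, embdim, moduleLength_eq]
  ring

/-- The numerical part of the argument. -/
theorem shape_of_ineq (b : ℕ → ℕ) (e r : ℕ) (hr : 1 ≤ r) (he : 1 + r ≤ e)
    (h : ∀ i, e * b (i + 1) ≤ b (i + 2) + r * b i) :
    ∃ (n : ℕ) (m : ℕ∞), (n : ℕ∞) ≤ m ∧
      (∀ i : ℕ, i < n → b (i + 1) < b i) ∧
      (∀ i : ℕ, n ≤ i → (i : ℕ∞) ≤ m → b i = b n) ∧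
      (∀ i : ℕ, m ≤ (i : ℕ∞) → b i < b (i + 1)) := by
  classical
  have hle : ∀ i, b i ≤ b (i + 1) → b (i + 1) ≤ b (i + 2) := by
    intro i hi
    have := h i
    nlinarith [Nat.mul_le_mul_right (b (i+1)) he, Nat.mul_le_mul_left r hi]
  have hlt : ∀ i, b i < b (i + 1) → b (i + 1) < b (i + 2) := by
    intro i hi
    have := h i
    nlinarith [Nat.mul_le_mul_right (b (i+1)) he, Nat.mul_lt_mul_of_pos_left hi hr]
  have hex : ∃ n, b n ≤ b (n + 1) := by
    by_contra hc
    push Not at hc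
    have : ∀ n, b n + n ≤ b 0 := by
      intro n
      induction n with
      | zero => simp
      | succ n ih => have := hc n; omega
    have := this (b 0 + 1)
    omega
  have hinc : ∀ i, Nat.find hex ≤ i → b i ≤ b (i + 1) := by
    intro i hi
    induction i, hi using Nat.le_induction with
    | base => exact Nat.find_spec hex
    | succ i _ ih => exact hle i ih
  have hdec : ∀ i, i < Nat.find hex → b (i + 1) < b i := by
    intro i hi
    have := Nat.find_min hex hi
    omega
  by_cases hm : ∃ m, Nat.find hex ≤ m ∧ b m < b (m + 1)
  · refine ⟨Nat.find hex, (Nat.find hm : ℕ), ?_, hdec, ?_, ?_⟩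
    · exact_mod_cast (Nat.find_spec hm).1
    · intro i hi him
      replace him : i ≤ Nat.find hm := by exact_mod_cast him
      induction i, hi using Nat.le_induction with
      | base => rfl
      | succ i hi ih =>
        have h1 := ih (by omega)
        have h2 := Nat.find_min hm (show i < Nat.find hm by omega)
        have h3 := hinc i hi
        have : ¬ b i < b (i + 1) := fun hh => h2 ⟨hi, hh⟩
        omega
    · intro i hi
      replace hi : Nat.find hm ≤ i := by exact_mod_cast hi
      induction i, hi using Nat.le_induction with
      | base => exact (Nat.find_spec hm).2
      | succ i _ ih => exact hlt i ih
  · refine ⟨Nat.find hex, ⊤, le_top, hdec, ?_, ?_⟩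
    · intro i hi hi'
      clear hi'
      induction i, hi using Nat.le_induction with
      | base => rfl
      | succ i hi ih =>
        have h3 := hinc i hi
        have : ¬ b i < b (i + 1) := fun hh => hm ⟨i, hi, hh⟩
        omega
    · intro i hi
      simp at hi

section MinimalResolution

variable (R : Type) [CommRing R] [IsNoetherianRing R] [IsLocalRing R]

/-- A finitely generated module, bundled. -/
structure FinMod where
  carrier : ModuleCat.{0} R
  fin : Module.Finite R carrier

variable {R}

attribute [instance] FinMod.fin

set_option linter.unusedSectionVars false

/-- The minimal number of generators. -/
noncomputable def FinMod.rk (N : FinMod R) : ℕ := (exists_min_cover R N.carrier).choose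

/-- The minimal free cover. -/
noncomputable def FinMod.cov (N : FinMod R) : (Fin N.rk → R) →ₗ[R] N.carrier :=
  (exists_min_cover R N.carrier).choose_spec.choose

theorem FinMod.cov_surj (N : FinMod R) : Function.Surjective N.cov :=
  (exists_min_cover R N.carrier).choose_spec.choose_spec.1

theorem FinMod.cov_min (N : FinMod R) : ∀ x, N.cov x = 0 → ∀ i, x i ∈ maximalIdeal R :=
  (exists_min_cover R N.carrier).choose_spec.choose_spec.2

/-- The first syzygy. -/
noncomputable def FinMod.next (N : FinMod R) : FinMod R :=
  ⟨ModuleCat.of R (LinearMap.ker N.cov), inferInstanceAs (Module.Finite R (LinearMap.ker N.cov))⟩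

/-- The differential from the cover of the syzygy to the cover. -/
noncomputable def FinMod.diff (N : FinMod R) : (Fin N.next.rk → R) →ₗ[R] (Fin N.rk → R) :=
  (LinearMap.ker N.cov).subtype ∘ₗ N.next.cov

theorem FinMod.exact_diff_cov (N : FinMod R) : Function.Exact N.diff N.cov := by
  intro x
  constructor
  · intro hx
    obtain ⟨y, hy⟩ := N.next.cov_surj (⟨x, hx⟩ : LinearMap.ker N.cov)
    exact ⟨y, congrArg Subtype.val hy⟩
  · rintro ⟨y, rfl⟩
    exact (show LinearMap.ker N.cov from N.next.cov y).2

theorem FinMod.diff_mem (N : FinMod R) (x) (i) : N.diff x i ∈ maximalIdeal R :=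
  N.cov_min _ ((N.exact_diff_cov _).2 ⟨x, rfl⟩) i

theorem FinMod.exact_diff_diff (N : FinMod R) : Function.Exact N.next.diff N.diff := by
  intro x
  rw [← N.next.exact_diff_cov x]
  constructor
  · intro h
    exact Subtype.ext h
  · intro h
    exact congrArg Subtype.val h

/-- Iterated syzygies. -/
noncomputable def FinMod.syz (N : FinMod R) : ℕ → FinMod R
  | 0 => N
  | n + 1 => (N.syz n).next

/-- The minimal free resolution as a complex. -/
noncomputable def FinMod.cplx (N : FinMod R) : ChainComplex (ModuleCat.{0} R) ℕ :=
  ChainComplex.of (fun n => ModuleCat.of R (Fin (N.syz n).rk → R))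
    (fun n => ModuleCat.ofHom (N.syz n).diff)
    (fun n => by
      ext1
      exact (N.syz n).exact_diff_diff.linearMap_comp_eq_zero)

theorem FinMod.cplx_d (N : FinMod R) (n : ℕ) :
    N.cplx.d (n + 1) n = ModuleCat.ofHom (N.syz n).diff :=
  ChainComplex.of_d (fun n => ModuleCat.of R (Fin (N.syz n).rk → R))
    (fun n => ModuleCat.ofHom (N.syz n).diff) n

theorem FinMod.cplx_exactAt (N : FinMod R) (n : ℕ) : N.cplx.ExactAt (n + 1) := by
  rw [HomologicalComplex.exactAt_iff' _ (n + 1 + 1) (n + 1) n (by simp) (by simp)]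
  rw [ShortComplex.ShortExact.moduleCat_exact_iff_function_exact]
  change Function.Exact (N.cplx.d (n + 1 + 1) (n + 1)) (N.cplx.d (n + 1) n)
  rw [N.cplx_d, N.cplx_d]
  exact (N.syz n).exact_diff_diff

theorem FinMod.cov_exact (N : FinMod R) (w) :
    (ShortComplex.mk (ModuleCat.ofHom N.diff) (ModuleCat.ofHom N.cov) w).Exact := by
  rw [ShortComplex.ShortExact.moduleCat_exact_iff_function_exact]
  exact N.exact_diff_cov

theorem FinMod.cplx_d_cov (N : FinMod R) :
    N.cplx.d 1 0 ≫ (ModuleCat.ofHom N.cov : N.cplx.X 0 ⟶ N.carrier) = 0 := by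
  rw [N.cplx_d 0]
  ext1
  exact N.exact_diff_cov.linearMap_comp_eq_zero

/-- The minimal free resolution. -/
noncomputable def FinMod.res (N : FinMod R) : ProjectiveResolution N.carrier where
  complex := N.cplx
  projective n := inferInstanceAs (Projective (ModuleCat.of R (Fin (N.syz n).rk → R)))
  π := (ChainComplex.toSingle₀Equiv _ _).symm ⟨ModuleCat.ofHom N.cov, N.cplx_d_cov⟩
  quasiIso := ⟨fun n => by
    cases n
    · rw [ChainComplex.quasiIsoAt₀_iff, ShortComplex.quasiIso_iff_of_zeros']
      · refine (ShortComplex.exact_and_epi_g_iff_of_iso ?_).2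
          ⟨N.cov_exact (by ext1; exact N.exact_diff_cov.linearMap_comp_eq_zero),
            (ModuleCat.epi_iff_surjective _).2 N.cov_surj⟩
        exact ShortComplex.isoMk (Iso.refl _) (Iso.refl _) (Iso.refl _)
          (by
            refine (Category.id_comp _).trans (Eq.trans ?_ (Category.comp_id _).symm)
            exact (N.cplx_d 0).symm)
          (by
            refine (Category.id_comp _).trans (Eq.trans ?_ (Category.comp_id _).symm)
            simp
            rfl)
      all_goals rfl
    · rw [quasiIsoAt_iff_exactAt']
      · apply N.cplx_exactAt
      · apply ChainComplex.exactAt_succ_single_obj⟩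

theorem FinMod.d_zero (N : FinMod R) (i j : ℕ) :
    (N.cplx.linearYonedaObj R (ModuleCat.of R (ResidueField R))).d i j = 0 := by
  by_cases h : i + 1 = j
  · subst h
    ext (f : N.cplx.X i ⟶ ModuleCat.of R (ResidueField R))
    change N.cplx.d (i + 1) i ≫ f = 0
    rw [N.cplx_d i]
    ext1
    change f.hom ∘ₗ (N.syz i).diff = 0
    refine LinearMap.ext fun x => ?_
    set y := (N.syz i).diff x with hy
    have hs : y = ∑ j, y j • (Pi.single j (1 : R) : Fin (N.syz i).rk → R) := by
      funext l
      simp [Finset.sum_apply, Pi.single_apply]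
    change f.hom y = 0
    rw [hs]
    refine (map_sum (f.hom : (Fin (N.syz i).rk → R) →ₗ[R] ResidueField R) _ _).trans ?_
    refine Finset.sum_eq_zero fun j _ => ?_
    refine (map_smul (f.hom : (Fin (N.syz i).rk → R) →ₗ[R] ResidueField R) _ _).trans ?_
    rw [Algebra.smul_def]
    have : algebraMap R (ResidueField R) (y j) = 0 :=
      (residue_eq_zero_iff _).2 ((N.syz i).diff_mem x j)
    rw [this, zero_mul]
  · exact HomologicalComplex.shape _ _ _ (by simpa using h)

theorem FinMod.betti (N : FinMod R) (n : ℕ) :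
    bettiNum R N.carrier n = (N.syz n).rk := by
  let P := N.res
  let Y := ModuleCat.of R (ResidueField R)
  let C := N.cplx.linearYonedaObj R Y
  have e1 := (N.res.isoExt (R := R) n Y).toLinearEquiv
  have e2 := ((ShortComplex.LeftHomologyData.ofZeros (C.sc n) (N.d_zero _ _) (N.d_zero _ _)).homologyIso).toLinearEquiv
  have e3 : (N.cplx.X n ⟶ Y) ≃ₗ[R] ((Fin (N.syz n).rk → R) →ₗ[R] ResidueField R) :=
    ModuleCat.homLinearEquiv
  have e4 : ((Fin (N.syz n).rk → R) →ₗ[R] ResidueField R) ≃ₗ[R] (Fin (N.syz n).rk → ResidueField R) :=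
    ((Pi.basisFun R (Fin (N.syz n).rk)).constr R).symm
  rw [bettiNum, moduleLength_eq]
  have h1 : Module.length R (ResidueField R) = 1 := length_residue R
  have h2 := (((e1.trans e2).trans e3).trans e4).length_eq
  refine h2.trans ?_
  simp [h1]

end MinimalResolution

/-- Let `(R, m, k)` be a local ring with `m³ = 0 ≠ m²`, `Soc R = m²` and `e ≥ 1 + r`.
For every nonzero finitely generated `R`-module `M` with `m²M = 0` there exist
`n : ℕ` and `m : ℕ∞` with `n ≤ m` (possibly `m = ∞`) such that the Betti sequence of `M`
is strictly decreasing for `i < n`, constant equal to `β_n` for `n ≤ i ≤ m`, and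
strictly increasing for `i ≥ m`. -/
theorem betti_sequence_shape (R : Type) [CommRing R] [IsNoetherianRing R] [IsLocalRing R]
    (h3 : maximalIdeal R ^ 3 = ⊥) (h2 : maximalIdeal R ^ 2 ≠ ⊥)
    (hsoc : socle R = maximalIdeal R ^ 2) (her : 1 + socdim R ≤ embdim R)
    (M : Type) [AddCommGroup M] [Module R M] [Module.Finite R M] [Nontrivial M]
    (hM : maximalIdeal R ^ 2 • (⊤ : Submodule R M) = ⊥) :
    ∃ (n : ℕ) (m : ℕ∞), (n : ℕ∞) ≤ m ∧
      (∀ i : ℕ, i < n → bettiNum R M (i + 1) < bettiNum R M i) ∧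
      (∀ i : ℕ, n ≤ i → (i : ℕ∞) ≤ m → bettiNum R M i = bettiNum R M n) ∧
      (∀ i : ℕ, m ≤ (i : ℕ∞) → bettiNum R M i < bettiNum R M (i + 1)) := by
  let N : FinMod R := ⟨ModuleCat.of R M, inferInstanceAs (Module.Finite R M)⟩
  have hb : ∀ i, bettiNum R M i = ((N.syz i).rk : ℕ∞) := fun i => N.betti i
  have hart : IsArtinianRing R := by
    rw [isArtinianRing_iff_isNilpotent_maximalIdeal]
    exact ⟨3, h3⟩
  have hle : maximalIdeal R ^ 2 ≤ socle R := hsoc.ge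
  obtain ⟨r, hr⟩ : ∃ r : ℕ, Module.length R ↥(maximalIdeal R ^ 2) = r := by
    obtain ⟨r, hr⟩ := ENat.ne_top_iff_exists.1
      (Module.length_ne_top (R := R) (M := ↥(maximalIdeal R ^ 2)))
    exact ⟨r, hr.symm⟩
  have hR := length_ring R
  have hRtop : Module.length R R ≠ ⊤ := Module.length_ne_top
  obtain ⟨e, he⟩ : ∃ e : ℕ, embdim R = e := by
    have : embdim R ≠ ⊤ := by
      intro h
      rw [h] at hR
      simp at hR
      exact hRtop hR
    obtain ⟨r, hr⟩ := ENat.ne_top_iff_exists.1 this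
    exact ⟨r, hr.symm⟩
  have hr1 : 1 ≤ r := by
    have : Nontrivial ↥(maximalIdeal R ^ 2) := Submodule.nontrivial_iff_ne_bot.2 h2
    have := Module.length_pos (R := R) (M := ↥(maximalIdeal R ^ 2))
    rw [hr] at this
    exact_mod_cast this
  have her' : 1 + r ≤ e := by
    rw [socdim, moduleLength_eq, hsoc, hr, he] at her
    exact_mod_cast her
  rw [hr, he] at hR
  simp only [hb, Nat.cast_lt, Nat.cast_inj]
  refine shape_of_ineq (fun i => (N.syz i).rk) e r hr1 her' ?_
  intro i
  have key : ∀ P : FinMod R, Module.length R P.next.carrier ≤ P.next.rk + P.rk * (r : ℕ∞) := by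
    intro P
    rw [← hr]
    exact length_le_of_cover R (LinearMap.ker P.cov) (fun x hx => P.cov_min x hx)
      P.next.cov P.next.cov_surj
  have k1 := key (N.syz i)
  have k2 := key (N.syz (i + 1))
  have hadd : Module.length R (Fin (N.syz (i + 1)).rk → R) =
      Module.length R (N.syz (i + 1)).next.carrier + Module.length R (N.syz (i + 1)).carrier :=
    Module.length_eq_add_of_exact (LinearMap.ker (N.syz (i + 1)).cov).subtype
      (N.syz (i + 1)).cov (Submodule.subtype_injective _) (N.syz (i + 1)).cov_surj
      (LinearMap.exact_subtype_ker_map _)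
  have hadd2 := hadd.le.trans (add_le_add k2 k1)
  rw [Module.length_pi, hR, ENat.card_eq_coe_fintype_card, Fintype.card_fin] at hadd2
  change (((N.syz (i + 1)).rk : ℕ) : ℕ∞) * (1 + e + r) ≤
    ((N.syz (i + 2)).rk : ℕ∞) + (N.syz (i + 1)).rk * r +
      ((N.syz (i + 1)).rk + (N.syz i).rk * r) at hadd2
  have hN : (N.syz (i + 1)).rk * (1 + e + r) ≤
    (N.syz (i + 2)).rk + (N.syz (i + 1)).rk * r +
      ((N.syz (i + 1)).rk + (N.syz i).rk * r) := by exact_mod_cast hadd2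
  nlinarith [hN]
end

section
/- Assume Soc R = m² and e > 1 + r. For every nonzero finitely generated R-module M with m²M = 0, the integers m ≥ n ≥ 0 describing the shape of the Betti sequence (strictly decreasing for i < n, constant equal to β_n^R(M) for n ≤ i ≤ m, strictly increasing for i ≥ m) satisfy m = n or m = n + 1; in particular m is finite and the constant part of the Betti sequence has length at most 2. -/
open IsLocalRing CategoryTheory

namespace BettiShape

/-- Minimal covers: a surjection from a finite free module with kernel inside `m F`. -/
lemma exists_cover (R : Type) [CommRing R] [IsLocalRing R] (M : Type) [AddCommGroup M]
    [Module R M] [Module.Finite R M] :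
    ∃ (b : ℕ) (f : (Fin b → R) →ₗ[R] M), Function.Surjective f ∧
      ∀ x, f x = 0 → ∀ i, x i ∈ maximalIdeal R := by
  classical
  have hex : ∃ b : ℕ, ∃ f : (Fin b → R) →ₗ[R] M, Function.Surjective f :=
    Module.Finite.exists_fin' R M
  obtain ⟨f, hf⟩ := Nat.find_spec hex
  have hmin : ∀ c, c < Nat.find hex → ¬ ∃ g : (Fin c → R) →ₗ[R] M, Function.Surjective g :=
    fun c hc => Nat.find_min hex hc
  generalize Nat.find hex = b at f hf hmin
  refine ⟨b, f, hf, fun x hx i => ?_⟩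
  by_contra hi
  rw [mem_maximalIdeal, mem_nonunits_iff, not_not] at hi
  obtain ⟨u, hu⟩ := hi
  obtain _ | c := b
  · exact i.elim0
  refine hmin c (Nat.lt_succ_self c) ?_
  let ins : (Fin c → R) →ₗ[R] (Fin (c + 1) → R) :=
    { toFun := fun z => i.insertNth (0 : R) z
      map_add' := fun y z => by
        ext j
        refine Fin.succAboveCases i ?_ (fun k => ?_) j <;> simp
      map_smul' := fun a z => by
        ext j
        refine Fin.succAboveCases i ?_ (fun k => ?_) j <;> simp }
  refine ⟨f ∘ₗ ins, fun y => ?_⟩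
  obtain ⟨z, rfl⟩ := hf y
  refine ⟨i.removeNth (z - (z i * ↑u⁻¹) • x), ?_⟩
  have h : ins (i.removeNth (z - (z i * ↑u⁻¹) • x)) = z - (z i * ↑u⁻¹) • x := by
    ext j
    refine Fin.succAboveCases i ?_ (fun k => ?_) j
    · simp [ins, ← hu, mul_assoc]
    · simp [ins, Fin.removeNth]
  rw [LinearMap.comp_apply, h, map_sub, map_smul, hx, smul_zero, sub_zero]

/-- A minimal free resolution, as a sequence of linear maps. -/
structure Res (R : Type) [CommRing R] [IsLocalRing R] (M : Type) [AddCommGroup M]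
    [Module R M] where
  b : ℕ → ℕ
  ε : (Fin (b 0) → R) →ₗ[R] M
  d : ∀ n, (Fin (b (n + 1)) → R) →ₗ[R] (Fin (b n) → R)
  surj : Function.Surjective ε
  ex0 : LinearMap.range (d 0) = LinearMap.ker ε
  ex : ∀ n, LinearMap.range (d (n + 1)) = LinearMap.ker (d n)
  min : ∀ n x i, d n x i ∈ maximalIdeal R

lemma exists_next {R : Type} [CommRing R] [IsNoetherianRing R] [IsLocalRing R] {N : Type}
    [AddCommGroup N] [Module R N] {b : ℕ} (f : (Fin b → R) →ₗ[R] N) :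
    ∃ (c : ℕ) (g : (Fin c → R) →ₗ[R] (Fin b → R)), LinearMap.range g = LinearMap.ker f ∧
      ∀ x, g x = 0 → ∀ i, x i ∈ maximalIdeal R := by
  obtain ⟨c, g, hg, hm⟩ := exists_cover R (LinearMap.ker f)
  refine ⟨c, (LinearMap.ker f).subtype ∘ₗ g, ?_, fun x hx => hm x ?_⟩
  · rw [LinearMap.range_comp, LinearMap.range_eq_top.mpr hg, Submodule.map_top,
      Submodule.range_subtype]
  · exact Subtype.ext hx

/-- The state of the recursion. -/
structure St (R : Type) [CommRing R] [IsLocalRing R] where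
  a : ℕ
  b : ℕ
  f : (Fin b → R) →ₗ[R] (Fin a → R)
  h : ∀ x, f x = 0 → ∀ i, x i ∈ maximalIdeal R

/-- The next step of the recursion. -/
noncomputable def St.next {R : Type} [CommRing R] [IsNoetherianRing R] [IsLocalRing R]
    (s : St R) : St R where
  a := s.b
  b := (exists_next s.f).choose
  f := (exists_next s.f).choose_spec.choose
  h := (exists_next s.f).choose_spec.choose_spec.2

/-- All steps of the recursion. -/
noncomputable def St.seq {R : Type} [CommRing R] [IsNoetherianRing R] [IsLocalRing R]
    (s : St R) : ℕ → St R
  | 0 => s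
  | n + 1 => (St.seq s n).next

lemma exists_res (R : Type) [CommRing R] [IsNoetherianRing R] [IsLocalRing R] (M : Type)
    [AddCommGroup M] [Module R M] [Module.Finite R M] : Nonempty (Res R M) := by
  obtain ⟨b0, ε, hε, hm⟩ := exists_cover R M
  obtain ⟨b1, g, hg, hgm⟩ := exists_next ε
  let s : St R := ⟨b0, b1, g, hgm⟩
  have hex : ∀ n, LinearMap.range (s.seq (n + 1)).f = LinearMap.ker (s.seq n).f :=
    fun n => (exists_next (s.seq n).f).choose_spec.choose_spec.1
  refine ⟨{ b := fun n => (s.seq n).a, ε := ε, d := fun n => (s.seq n).f, surj := hε,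
            ex0 := hg, ex := hex, min := ?_ }⟩
  rintro (_ | n) x i
  · refine hm _ ?_ i
    have : g x ∈ LinearMap.ker ε := hg ▸ LinearMap.mem_range_self g x
    exact this
  · refine (s.seq n).h _ ?_ i
    have : (s.seq (n+1)).f x ∈ LinearMap.ker (s.seq n).f := hex n ▸ LinearMap.mem_range_self _ x
    exact this

lemma moduleLength_eq (R M : Type) [Ring R] [AddCommGroup M] [Module R M] :
    moduleLength R M = Module.length R M := by
  apply WithBot.coe_injective
  rw [Module.coe_length, Order.krullDim_eq_iSup_length]
  rfl

lemma length_residue (R : Type) [CommRing R] [IsLocalRing R] :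
    Module.length R (ResidueField R) = 1 := by
  have : IsSimpleModule R (ResidueField R) :=
    isSimpleModule_iff_quot_maximal.mpr
      ⟨maximalIdeal R, inferInstance, ⟨LinearEquiv.refl R (ResidueField R)⟩⟩
  exact Module.length_eq_one R _

section Count

variable {R : Type} [CommRing R] [IsLocalRing R]

lemma length_quot_le {N : Type} [AddCommGroup N] [Module R N] {b : ℕ}
    (f : (Fin b → R) →ₗ[R] N) (hf : Function.Surjective f) :
    Module.length R (N ⧸ (maximalIdeal R • (⊤ : Submodule R N))) ≤ b := by
  let I := maximalIdeal R
  let q : N →ₗ[R] N ⧸ (I • (⊤ : Submodule R N)) := Submodule.mkQ _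
  have hz : ∀ i : Fin b, I ≤ LinearMap.ker (LinearMap.toSpanSingleton R _ (q (f (Pi.single i 1)))) := by
    intro i x hx
    rw [LinearMap.mem_ker, LinearMap.toSpanSingleton_apply, ← map_smul]
    exact (Submodule.Quotient.mk_eq_zero _).mpr (Submodule.smul_mem_smul hx trivial)
  let g : (Fin b → R ⧸ I) →ₗ[R] N ⧸ (I • (⊤ : Submodule R N)) :=
    LinearMap.lsum R (fun _ => R ⧸ I) R fun i => Submodule.liftQ I _ (hz i)
  have hg : Function.Surjective g := by
    intro y
    obtain ⟨y, rfl⟩ := Submodule.mkQ_surjective _ y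
    obtain ⟨x, rfl⟩ := hf y
    refine ⟨fun i => Submodule.Quotient.mk (x i), ?_⟩
    conv_rhs => rw [pi_eq_sum_univ' x]
    simp only [g, LinearMap.lsum_apply, map_sum, map_smul, LinearMap.sum_apply,
      LinearMap.comp_apply, LinearMap.proj_apply]
    rfl
  refine (Module.length_le_of_surjective g hg).trans ?_
  rw [Module.length_pi_of_fintype]
  have : Module.length R (R ⧸ I) = 1 := length_residue R
  simp [this]

lemma length_split {N : Type} [AddCommGroup N] [Module R N] (K : Submodule R N) :
    Module.length R N = Module.length R K + Module.length R (N ⧸ K) :=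
  Module.length_eq_add_of_exact (Submodule.subtype K) (Submodule.mkQ K)
    (Submodule.subtype_injective K) (Submodule.mkQ_surjective K) (LinearMap.exact_subtype_mkQ K)

lemma length_le_of_embedding {N : Type} [AddCommGroup N] [Module R N] {a b : ℕ}
    (f : (Fin b → R) →ₗ[R] N) (hf : Function.Surjective f)
    (t : N →ₗ[R] (Fin a → R)) (ht : Function.Injective t)
    (hm : ∀ x i, t x i ∈ maximalIdeal R) :
    Module.length R N ≤ a * Module.length R ↥(maximalIdeal R ^ 2) + b := by
  let K : Submodule R N := maximalIdeal R • ⊤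
  have h2 : Module.length R (N ⧸ K) ≤ b := length_quot_le f hf
  have hK : ∀ x : N, x ∈ K → ∀ i, t x i ∈ maximalIdeal R ^ 2 := by
    intro x hx i
    refine Submodule.smul_induction_on hx ?_ ?_
    · intro r hr z _
      rw [pow_two, map_smul]
      exact Ideal.mul_mem_mul hr (hm z i)
    · intro x y hx hy
      rw [map_add]
      exact Ideal.add_mem _ hx hy
  let j : K →ₗ[R] (Fin a → ↥(maximalIdeal R ^ 2)) :=
    LinearMap.pi fun i => LinearMap.codRestrict (maximalIdeal R ^ 2)
      (LinearMap.proj i ∘ₗ t ∘ₗ K.subtype) (fun x => hK x x.2 i)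
  have hj : Function.Injective j := by
    intro x y h
    apply Subtype.ext
    apply ht
    funext i
    exact congrArg Subtype.val (congrFun h i)
  have h3 := Module.length_le_of_injective j hj
  rw [Module.length_pi_of_fintype] at h3
  simp only [Finset.sum_const, Finset.card_univ, Fintype.card_fin, nsmul_eq_mul] at h3
  rw [length_split K]
  exact add_le_add h3 h2

lemma length_range_le {a b : ℕ} (f : (Fin b → R) →ₗ[R] (Fin a → R))
    (hf : ∀ x i, f x i ∈ maximalIdeal R) :
    Module.length R (LinearMap.range f) ≤
      a * Module.length R ↥(maximalIdeal R ^ 2) + b := by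
  refine length_le_of_embedding f.rangeRestrict f.surjective_rangeRestrict
    (LinearMap.range f).subtype (Submodule.subtype_injective _) ?_
  rintro ⟨_, z, rfl⟩ i
  exact hf z i

lemma length_ring : Module.length R R =
    Module.length R ↥(maximalIdeal R ^ 2) + Module.length R (CotangentSpace R) + 1 := by
  let I := maximalIdeal R
  have h1 := Module.length_eq_add_of_exact (Submodule.subtype I) (Submodule.mkQ I)
    (Submodule.subtype_injective I) (Submodule.mkQ_surjective I) (LinearMap.exact_subtype_mkQ I)
  have h2 := Module.length_eq_add_of_exact (LinearMap.ker I.toCotangent).subtype I.toCotangent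
    (Submodule.subtype_injective _) I.toCotangent_surjective
    (LinearMap.exact_subtype_ker_map _)
  have h3 : Module.length R (LinearMap.ker I.toCotangent) = Module.length R ↥(I ^ 2) := by
    rw [← I.map_toCotangent_ker]
    exact (Submodule.equivMapOfInjective _ (Submodule.subtype_injective I) _).length_eq
  have h4 : Module.length R (R ⧸ I) = 1 := length_residue R
  rw [h1, h2, h3, h4]

lemma count {M : Type} [AddCommGroup M] [Module R M] (P : Res R M) (n : ℕ)
    (r : ℕ) (hr : Module.length R ↥(maximalIdeal R ^ 2) = r)
    (e : ℕ) (he : Module.length R (CotangentSpace R) = e) :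
    P.b (n + 1) * e ≤ P.b n * r + P.b (n + 2) := by
  have h0 := length_range_le (P.d n) (P.min n)
  have h1 := length_range_le (P.d (n + 1)) (P.min (n + 1))
  rw [P.ex n] at h1
  have h2 := Module.length_eq_add_of_exact (LinearMap.ker (P.d n)).subtype (P.d n).rangeRestrict
    (Submodule.subtype_injective _) (P.d n).surjective_rangeRestrict
    (by
      rw [LinearMap.exact_iff, LinearMap.ker_rangeRestrict, Submodule.range_subtype])
  rw [Module.length_pi_of_fintype] at h2
  simp only [Finset.sum_const, Finset.card_univ, Fintype.card_fin, nsmul_eq_mul] at h2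
  rw [length_ring, hr, he] at h2
  rw [hr] at h0 h1
  have h3 := h2.le.trans (add_le_add h1 h0)
  norm_cast at h3
  have : P.b (n + 1) * (r + e + 1) = P.b (n+1) * e + P.b (n+1) * r + P.b (n+1) := by ring
  have e2 : n + 1 + 1 = n + 2 := rfl
  rw [e2] at h3
  omega

lemma pos {M : Type} [AddCommGroup M] [Module R M] [Nontrivial M] (P : Res R M)
    (h3 : maximalIdeal R ^ 3 = ⊥) (h2 : maximalIdeal R ^ 2 ≠ ⊥)
    (hM : maximalIdeal R ^ 2 • (⊤ : Submodule R M) = ⊥) (n : ℕ) : 0 < P.b n := by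
  obtain ⟨t, ht, ht0⟩ := Submodule.exists_mem_ne_zero_of_ne_bot h2
  induction n with
  | zero =>
    by_contra h
    have h : P.b 0 = 0 := by omega
    have : IsEmpty (Fin (P.b 0)) := by rw [h]; infer_instance
    have := P.surj.subsingleton
    exact not_subsingleton M this
  | succ n ih =>
    by_contra h
    have h : P.b (n + 1) = 0 := by omega
    have : IsEmpty (Fin (P.b (n + 1))) := by rw [h]; infer_instance
    let x : Fin (P.b n) → R := t • Pi.single ⟨0, ih⟩ 1
    have hx : x ≠ 0 := fun h0 => ht0 (by simpa [x] using congrFun h0 ⟨0, ih⟩)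
    have key : x ∈ LinearMap.range (P.d n) := by
      obtain _ | n := n
      · rw [P.ex0, LinearMap.mem_ker, map_smul, ← Submodule.mem_bot R, ← hM]
        exact Submodule.smul_mem_smul ht trivial
      · rw [P.ex, LinearMap.mem_ker, map_smul]
        funext i
        rw [Pi.zero_apply, ← Submodule.mem_bot R, ← h3, pow_succ]
        exact Ideal.mul_mem_mul ht (P.min _ _ i)
    obtain ⟨y, hy⟩ := key
    apply hx
    rw [← hy, Subsingleton.elim y 0, map_zero]

end Count


section Ext

variable {R : Type} [CommRing R] [IsLocalRing R] {M : Type} [AddCommGroup M] [Module R M]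

/-- The chain complex of a minimal resolution. -/
noncomputable def Res.cx (P : Res R M) : ChainComplex (ModuleCat R) ℕ :=
  ChainComplex.of (fun n => ModuleCat.of R (Fin (P.b n) → R)) (fun n => ModuleCat.ofHom (P.d n))
    (fun n => by
      rw [← ModuleCat.ofHom_comp]
      have : P.d n ∘ₗ P.d (n + 1) = 0 := by
        apply LinearMap.ext
        intro x
        have : P.d (n + 1) x ∈ LinearMap.ker (P.d n) := P.ex n ▸ LinearMap.mem_range_self _ x
        exact this
      rw [this]
      rfl)

lemma Res.cx_d (P : Res R M) (n : ℕ) : P.cx.d (n + 1) n = ModuleCat.ofHom (P.d n) :=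
  ChainComplex.of_d (fun n => ModuleCat.of R (Fin (P.b n) → R))
    (fun n => ModuleCat.ofHom (P.d n)) n

/-- The augmentation. -/
noncomputable def Res.aug (P : Res R M) : P.cx.X 0 ⟶ ModuleCat.of R M :=
  ModuleCat.ofHom P.ε

lemma Res.d_ε (P : Res R M) : P.cx.d 1 0 ≫ P.aug = 0 := by
  rw [P.cx_d 0]
  apply ModuleCat.hom_ext
  apply LinearMap.ext
  intro x
  have : P.d 0 x ∈ LinearMap.ker P.ε := P.ex0 ▸ LinearMap.mem_range_self _ x
  exact this

/-- The projective resolution. -/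
noncomputable def Res.proj (P : Res R M) : ProjectiveResolution (ModuleCat.of R M) where
  complex := P.cx
  projective n := by
    change Projective (ModuleCat.of R (Fin (P.b n) → R))
    infer_instance
  π := (ChainComplex.toSingle₀Equiv _ _).symm ⟨P.aug, P.d_ε⟩
  quasiIso := ⟨fun n => by
    cases n
    · rw [ChainComplex.quasiIsoAt₀_iff, ShortComplex.quasiIso_iff_of_zeros']
      · have h : (ShortComplex.mk _ _ P.d_ε).Exact ∧ Epi (ShortComplex.mk _ _ P.d_ε).g := by
          constructor
          · rw [ShortComplex.moduleCat_exact_iff_range_eq_ker]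
            change LinearMap.range (P.cx.d 1 0).hom = LinearMap.ker P.ε
            rw [P.cx_d 0]
            exact P.ex0
          · exact (ModuleCat.epi_iff_surjective _).mpr P.surj
        have hz : ((ChainComplex.toSingle₀Equiv P.cx (ModuleCat.of R M)).symm
            ⟨P.aug, P.d_ε⟩).f 0 = P.aug :=
          ChainComplex.toSingle₀Equiv_symm_apply_f_zero (P.aug) P.d_ε
        refine (ShortComplex.exact_and_epi_g_iff_of_iso ?_).2 h
        exact ShortComplex.isoMk (Iso.refl _) (Iso.refl _) (Iso.refl _)
          ((Category.id_comp _).trans (Category.comp_id _).symm)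
          ((Category.id_comp _).trans (Eq.trans hz.symm (Category.comp_id _).symm))
      all_goals rfl
    · rename_i n
      rw [quasiIsoAt_iff_exactAt']
      · rw [HomologicalComplex.exactAt_iff' _ (n + 1 + 1) (n + 1) n (by simp) (by simp),
          ShortComplex.moduleCat_exact_iff_range_eq_ker]
        change LinearMap.range (P.cx.d (n + 1 + 1) (n + 1)).hom =
          LinearMap.ker (P.cx.d (n + 1) n).hom
        rw [P.cx_d, P.cx_d]
        exact P.ex n
      · apply ChainComplex.exactAt_succ_single_obj⟩

lemma hom_d_zero {a b : ℕ} (f : (Fin b → R) →ₗ[R] (Fin a → R))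
    (hf : ∀ x i, f x i ∈ maximalIdeal R) (g : (Fin a → R) →ₗ[R] ResidueField R) : g ∘ₗ f = 0 := by
  ext x
  simp only [LinearMap.comp_apply, LinearMap.zero_apply]
  rw [pi_eq_sum_univ' (f _), map_sum]
  refine Finset.sum_eq_zero fun i _ => ?_
  rw [map_smul, Algebra.smul_def]
  have : algebraMap R (ResidueField R) (f (LinearMap.single R (fun _ => R) x 1) i) = 0 :=
    (residue_eq_zero_iff _).mpr (hf _ i)
  erw [this, zero_mul]

lemma Res.yoneda_d (P : Res R M) (i j : ℕ) :
    (P.cx.linearYonedaObj R (ModuleCat.of R (ResidueField R))).d i j = 0 := by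
  by_cases h : i + 1 = j
  · subst h
    ext g : 2
    change P.cx.d (i + 1) i ≫ g = 0
    rw [P.cx_d]
    ext x : 2
    exact LinearMap.congr_fun (hom_d_zero (P.d i) (P.min i) g.hom) x
  · exact HomologicalComplex.shape _ _ _ h

lemma Res.betti (P : Res R M) (n : ℕ) : bettiNum R M n = P.b n := by
  let C := P.cx.linearYonedaObj R (ModuleCat.of R (ResidueField R))
  let e1 : extModule R M (ResidueField R) n ≅ C.homology n := P.proj.isoExt n _
  let e2 : C.homology n ≅ C.X n :=
    (ShortComplex.HomologyData.ofZeros (C.sc n) (P.yoneda_d _ _) (P.yoneda_d _ _)).left.homologyIso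
  have e3 : C.X n ≃ₗ[R] ((Fin (P.b n) → R) →ₗ[R] ResidueField R) :=
    ModuleCat.homLinearEquiv (S := R) (M := ModuleCat.of R (Fin (P.b n) → R))
      (N := ModuleCat.of R (ResidueField R))
  rw [bettiNum, moduleLength_eq, (e1 ≪≫ e2).toLinearEquiv.length_eq, e3.length_eq,
    ← ((Pi.basisFun R (Fin (P.b n))).constr R (M' := ResidueField R)).length_eq,
    Module.length_pi_of_fintype]
  simp [length_residue]

end Ext

end BettiShape

/-- Let `(R, m, k)` be a local ring with `m³ = 0 ≠ m²`, `Soc R = m²` and `e > 1 + r`.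
For every nonzero finitely generated `R`-module `M` with `m²M = 0` there exist natural
numbers `m ≥ n ≥ 0` (in particular `m` is finite) describing the shape of the Betti
sequence of `M` (strictly decreasing for `i < n`, constant for `n ≤ i ≤ m`, strictly
increasing for `i ≥ m`) such that `m = n` or `m = n + 1`. -/
theorem betti_sequence_shape_of_lt (R : Type) [CommRing R] [IsNoetherianRing R] [IsLocalRing R]
    (h3 : maximalIdeal R ^ 3 = ⊥) (h2 : maximalIdeal R ^ 2 ≠ ⊥)
    (hsoc : socle R = maximalIdeal R ^ 2) (her : 1 + socdim R < embdim R)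
    (M : Type) [AddCommGroup M] [Module R M] [Module.Finite R M] [Nontrivial M]
    (hM : maximalIdeal R ^ 2 • (⊤ : Submodule R M) = ⊥) :
    ∃ n m : ℕ, n ≤ m ∧
      (∀ i : ℕ, i < n → bettiNum R M (i + 1) < bettiNum R M i) ∧
      (∀ i : ℕ, n ≤ i → i ≤ m → bettiNum R M i = bettiNum R M n) ∧
      (∀ i : ℕ, m ≤ i → bettiNum R M i < bettiNum R M (i + 1)) ∧
      (m = n ∨ m = n + 1) := by
  obtain ⟨P⟩ := BettiShape.exists_res R M
  have hart : IsArtinianRing R :=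
    (isArtinianRing_iff_isNilpotent_maximalIdeal R).mpr ⟨3, h3⟩
  obtain ⟨r, hr⟩ := ENat.ne_top_iff_exists.mp (Module.length_ne_top (R := R) (M := ↥(maximalIdeal R ^ 2)))
  have hfin : Module.length R (CotangentSpace R) ≠ ⊤ := by
    have h := BettiShape.length_ring (R := R)
    intro h'
    rw [h'] at h
    exact Module.length_ne_top (R := R) (M := R) (by simpa using h)
  obtain ⟨e, he⟩ := ENat.ne_top_iff_exists.mp hfin
  have hlt : 1 + r < e := by
    rw [socdim, embdim, BettiShape.moduleLength_eq, BettiShape.moduleLength_eq, hsoc, ← hr,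
      ← he] at her
    exact_mod_cast her
  have hpos := BettiShape.pos P h3 h2 hM
  have hcount := fun n => BettiShape.count P n r hr.symm e he.symm
  simp only [P.betti, Nat.cast_lt, Nat.cast_inj]
  generalize P.b = b at hpos hcount
  have step : ∀ n, b n ≤ b (n + 1) → b (n + 1) < b (n + 2) := by
    intro n hn
    have h1 := hcount n
    have h2 := hpos (n + 1)
    nlinarith
  have hex : ∃ n, b n ≤ b (n + 1) := by
    by_contra! h
    have : ∀ n, b n + n ≤ b 0 := by
      intro n
      induction n with
      | zero => simp
      | succ n ih => have := h n; omega
    have h1 := this (b 0 + 1)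
    omega
  classical
  obtain ⟨n, hn, hmin⟩ : ∃ n, b n ≤ b (n + 1) ∧ ∀ i < n, b (i + 1) < b i :=
    ⟨Nat.find hex, Nat.find_spec hex, fun i hi => by
      have := Nat.find_min hex hi
      omega⟩
  have inc : ∀ i, n + 1 ≤ i → b i < b (i + 1) := by
    intro i hi
    induction i, hi using Nat.le_induction with
    | base => exact step n hn
    | succ i hi ih => exact step i ih.le
  rcases hn.lt_or_eq with hlt' | heq
  · refine ⟨n, n, le_rfl, hmin, fun i h1 h2 => by rw [le_antisymm h2 h1], fun i hi => ?_, Or.inl rfl⟩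
    rcases hi.eq_or_lt with rfl | hi
    · exact hlt'
    · exact inc i hi
  · refine ⟨n, n + 1, Nat.le_succ n, hmin, fun i h1 h2 => ?_, inc, Or.inr rfl⟩
    obtain rfl | rfl : i = n ∨ i = n + 1 := by omega
    · rfl
    · exact heq.symm
end

section
/- Assume R is not Gorenstein (equivalently, r ≥ 2). Let M be a nonzero finitely generated R-module with m²M = 0 such that Ext^h_R(M, R) = 0 for infinitely many h ≥ 1. Then (0 :_R m) = m², β_1^R(M) = e·β_0^R(M) − dim_k(mM), and β_i^R(M) = e·β_{i−1}^R(M) − r·β_{i−2}^R(M) for all i ≥ 2 (i.e., M is exceptional). -/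
open IsLocalRing CategoryTheory

namespace Exc
lemma moduleLength_eq (R M : Type) [Ring R] [AddCommGroup M] [Module R M] :
    moduleLength R M = Module.length R M := by
  rw [← WithBot.coe_inj, Module.coe_length, Order.krullDim_eq_iSup_length]
  rfl

lemma isSimple (R : Type) [CommRing R] [IsLocalRing R] : IsSimpleModule R (ResidueField R) := 
  isSimpleModule_iff_quot_maximal.mpr ⟨_, inferInstance, ⟨LinearEquiv.refl _ _⟩⟩

lemma preserves (R : Type) [CommRing R]  (N : ModuleCat.{0} R) :
    Limits.PreservesFiniteColimits ((linearYoneda R (ModuleCat.{0} R)).obj N).rightOp := by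
  have : Limits.PreservesLimits ((linearYoneda R (ModuleCat.{0} R)).obj N ⋙ forget _) :=
    (inferInstance : Limits.PreservesLimits (yoneda.obj N))
  have : Limits.PreservesLimits ((linearYoneda R (ModuleCat.{0} R)).obj N) :=
    Limits.preservesLimits_of_reflects_of_preserves _ (forget _)
  exact Limits.preservesFiniteColimits_rightOp _

variable (R : Type) [CommRing R] (M N : Type) [AddCommGroup M] [Module R M]
    [AddCommGroup N] [Module R N]

noncomputable def ext0 : extModule R M N 0 ≃ₗ[R] (M →ₗ[R] N) := by
  haveI := preserves R (ModuleCat.of R N)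
  let F := ((linearYoneda R (ModuleCat.{0} R)).obj (ModuleCat.of R N)).rightOp
  let e := (F.leftDerivedZeroIsoSelf.app (ModuleCat.of R M)).unop
  exact (e.toLinearEquiv.symm : _ ≃ₗ[R] (ModuleCat.of R M ⟶ ModuleCat.of R N)).trans
    (ModuleCat.homLinearEquiv (S := R))

/-- abbreviation -/
abbrev E (n : ℕ) : Type := Abelian.Ext.{0} (ModuleCat.of R M) (ModuleCat.of R N) n

lemma smul_extMk {M N : ModuleCat.{0} R} (P : ProjectiveResolution M) (n : ℕ)
    (f : P.complex.X n ⟶ N) (hf : P.complex.d (n+1) n ≫ f = 0) (r : R) :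
    P.extMk (r • f) (n+1) rfl (by rw [Linear.comp_smul, hf, smul_zero]) =
      r • P.extMk f (n+1) rfl hf := by
  rw [Abelian.Ext.smul_eq_comp_mk₀, P.extMk_comp_mk₀]
  simp only [Linear.comp_smul, Category.comp_id]

noncomputable def cyc {M N : ModuleCat.{0} R} (P : ProjectiveResolution M) (n : ℕ) :
   LinearMap.ker ((P.complex.linearYonedaObj R N).sc' n (n+1) (n+2)).g.hom →ₗ[R]
   Abelian.Ext.{0} M N (n+1) where
  toFun f := P.extMk (n := n+1) (Y := N) f.1 (n+2) rfl f.2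
  map_add' f g := (P.add_extMk _ _ _ rfl f.2 g.2).symm
  map_smul' r f := smul_extMk R P _ f.1 f.2 r

lemma cyc_surj {M N : ModuleCat.{0} R} (P : ProjectiveResolution M) (n : ℕ) :
    Function.Surjective (cyc R P (N := N) n) := by
  intro α
  obtain ⟨f, hf, rfl⟩ := P.extMk_surjective α (n+2) rfl
  exact ⟨⟨f, hf⟩, rfl⟩

lemma cyc_ker {M N : ModuleCat.{0} R} (P : ProjectiveResolution M) (n : ℕ) :
    LinearMap.ker (cyc R P (N := N) n) = LinearMap.range ((P.complex.linearYonedaObj R N).sc' n (n+1) (n+2)).moduleCatToCycles := by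
  ext ⟨f, hf⟩
  rw [LinearMap.mem_ker, LinearMap.mem_range]
  change P.extMk (n := n+1) (Y := N) f (n+2) rfl hf = 0 ↔ _
  refine (P.extMk_eq_zero_iff _ _ _ _ n rfl).trans ?_
  constructor
  · rintro ⟨g, hg⟩
    exact ⟨g, Subtype.ext hg⟩
  · rintro ⟨g, hg⟩
    exact ⟨g, congrArg Subtype.val hg⟩

noncomputable def extSucc (n : ℕ) : extModule R M N (n+1) ≃ₗ[R] E R M N (n+1) := by
  let P := ProjectiveResolution.of (ModuleCat.of R M)
  let K := P.complex.linearYonedaObj R (ModuleCat.of R N)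
  let e1 := (P.isoExt (R := R) (n+1) (ModuleCat.of R N)).toLinearEquiv
  let e2 := (K.homologyIsoSc' n (n+1) (n+2) (by simp) (by simp)).toLinearEquiv
  let e3 := (K.sc' n (n+1) (n+2)).moduleCatHomologyIso.toLinearEquiv
  let e4 := (Submodule.quotEquivOfEq _ _ (cyc_ker R P (N := ModuleCat.of R N) n)).symm.trans
    ((cyc R P (N := ModuleCat.of R N) n).quotKerEquivOfSurjective (cyc_surj R P n))
  exact ((e1.trans e2).trans e3).trans e4


section shift
variable {R M N}
variable {F : Type} [AddCommGroup F] [Module R F] (f : F →ₗ[R] M) (hf : Function.Surjective f)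

noncomputable def conn (n : ℕ) : E R (LinearMap.ker f) N n →ₗ[R] E R M N (n+1) where
  toFun x := (LinearMap.shortExact_shortComplexKer hf).extClass.comp x (add_comm 1 n)
  map_add' x y := Abelian.Ext.comp_add _ _ _ _
  map_smul' r x := Abelian.Ext.comp_smul _ _ _ _

lemma conn_surj [Module.Projective R F] (n : ℕ) : Function.Surjective (conn (N := N) f hf n) := by
  intro x
  have : Projective f.shortComplexKer.X₂ := 
    (IsProjective.iff_projective (R := R) F).mp inferInstance
  exact precomp_extClass_surjective_of_projective_X₂ _ (LinearMap.shortExact_shortComplexKer hf) n x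

noncomputable def shiftEquiv [Module.Projective R F] (n : ℕ) :
    E R (LinearMap.ker f) N (n+1) ≃ₗ[R] E R M N (n+2) := by
  refine LinearEquiv.ofBijective (conn f hf (n+1)) ⟨?_, conn_surj f hf _⟩
  rw [injective_iff_map_eq_zero]
  intro x hx
  have : Projective f.shortComplexKer.X₂ := 
    (IsProjective.iff_projective (R := R) F).mp inferInstance
  obtain ⟨y, hy⟩ := Abelian.Ext.contravariant_sequence_exact₁ 
    (LinearMap.shortExact_shortComplexKer hf) _ x (add_comm _ _) hx
  rw [← hy, Abelian.Ext.eq_zero_of_projective y, Abelian.Ext.comp_zero]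

noncomputable def e0 : E R M N 0 ≃ₗ[R] (M →ₗ[R] N) :=
  (Abelian.Ext.linearEquiv₀ (R := R)).trans (ModuleCat.homLinearEquiv (S := R))

lemma conn0_eq_zero (x : E R (LinearMap.ker f) N 0) (hx : conn f hf 0 x = 0) :
    ∃ g : F →ₗ[R] N, e0 x = g ∘ₗ (LinearMap.ker f).subtype := by
  obtain ⟨y, hy⟩ := Abelian.Ext.contravariant_sequence_exact₁ 
    (LinearMap.shortExact_shortComplexKer hf) _ x (add_comm _ _) hx
  refine ⟨e0 (M := F) y, ?_⟩
  obtain ⟨y, rfl⟩ := Abelian.Ext.linearEquiv₀ (R := R).symm.surjective y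
  obtain rfl : Abelian.Ext.mk₀ (f.shortComplexKer.f ≫ y) = x := by
    rw [← hy]
    exact (Abelian.Ext.mk₀_comp_mk₀ _ _).symm
  apply LinearMap.ext
  intro z
  change (ModuleCat.Hom.hom (Abelian.Ext.linearEquiv₀ (R := R) (Abelian.Ext.linearEquiv₀ (R := R).symm (f.shortComplexKer.f ≫ y)))) z = (ModuleCat.Hom.hom (Abelian.Ext.linearEquiv₀ (R := R) (Abelian.Ext.linearEquiv₀ (R := R).symm y))) z.1
  rw [LinearEquiv.apply_symm_apply, LinearEquiv.apply_symm_apply]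
  rfl

noncomputable def shiftZero [Module.Projective R F] 
    (h : ∀ g : F →ₗ[R] N, g ∘ₗ (LinearMap.ker f).subtype = 0) :
    (LinearMap.ker f →ₗ[R] N) ≃ₗ[R] E R M N 1 := by
  refine e0.symm.trans (LinearEquiv.ofBijective (conn f hf 0) ⟨?_, conn_surj f hf _⟩)
  rw [injective_iff_map_eq_zero]
  intro x hx
  obtain ⟨g, hg⟩ := conn0_eq_zero f hf x hx
  rw [h] at hg
  exact e0.map_eq_zero_iff.mp hg

/-- vanishing of Ext^1 gives extensions -/

lemma extend_of_subsingleton (hf : Function.Surjective f) (h : Subsingleton (E R M N 1)) (φ : LinearMap.ker f →ₗ[R] N) :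
    ∃ g : F →ₗ[R] N, φ = g ∘ₗ (LinearMap.ker f).subtype := by
  obtain ⟨g, hg⟩ := conn0_eq_zero f hf (e0.symm φ) (Subsingleton.elim _ _)
  exact ⟨g, by rw [← hg, LinearEquiv.apply_symm_apply]⟩

end shift

section func
variable {R}

/-- Ext vanishing for retracts -/
lemma subsingleton_retract {A B C : Type} [AddCommGroup A] [Module R A] [AddCommGroup B] [Module R B]
    [AddCommGroup C] [Module R C]
    (i : A →ₗ[R] B) (p : B →ₗ[R] A) (h : p ∘ₗ i = LinearMap.id) (n : ℕ)
    (hB : Subsingleton (E R B C n)) : Subsingleton (E R A C n) := by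
  refine subsingleton_of_forall_eq 0 fun x => ?_
  have h1 : (Abelian.Ext.mk₀ (ModuleCat.ofHom i)).comp
     ((Abelian.Ext.mk₀ (ModuleCat.ofHom p)).comp x (zero_add _)) (zero_add _) = x := by
    rw [Abelian.Ext.mk₀_comp_mk₀_assoc, ← ModuleCat.ofHom_comp, h]
    exact Abelian.Ext.mk₀_id_comp x
  rw [← h1, @Subsingleton.elim _ hB ((Abelian.Ext.mk₀ (ModuleCat.ofHom p)).comp x (zero_add _)) 0,
    Abelian.Ext.comp_zero]

lemma subsingleton_exact {A B C N : Type} [AddCommGroup A] [Module R A] [AddCommGroup B] [Module R B]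
    [AddCommGroup C] [Module R C] [AddCommGroup N] [Module R N]
    (i : A →ₗ[R] B) (p : B →ₗ[R] C) (hi : Function.Injective i) (hp : Function.Surjective p)
    (he : Function.Exact i p) (n : ℕ)
    (hA : Subsingleton (E R A N n)) (hC : Subsingleton (E R C N n)) : Subsingleton (E R B N n) := by
  let S : ShortComplex (ModuleCat.{0} R) := ShortComplex.mk (ModuleCat.ofHom i) (ModuleCat.ofHom p)
    (by rw [← ModuleCat.ofHom_comp, he.linearMap_comp_eq_zero]; rfl)
  have hS : S.ShortExact := by
    have : Mono S.f := (ModuleCat.mono_iff_injective _).mpr hi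
    have : Epi S.g := (ModuleCat.epi_iff_surjective _).mpr hp
    exact ⟨(ShortComplex.ShortExact.moduleCat_exact_iff_function_exact S).mpr he⟩
  refine subsingleton_of_forall_eq 0 fun x => ?_
  obtain ⟨y, rfl⟩ := Abelian.Ext.contravariant_sequence_exact₂ hS (ModuleCat.of R N) x 
    (@Subsingleton.elim _ hA _ _)
  rw [@Subsingleton.elim _ hC y 0, Abelian.Ext.comp_zero]

end func

end Exc

namespace Exc

section loc
variable {R : Type} [CommRing R]

lemma mem_pi_iff (I : Ideal R) {n : ℕ} (c : Fin n → R) :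
    c ∈ I • (⊤ : Submodule R (Fin n → R)) ↔ ∀ i, c i ∈ I := by
  constructor
  · intro h
    refine Submodule.smul_induction_on h ?_ ?_
    · intro r hr x _ i
      exact I.mul_mem_right _ hr
    · intro x y hx hy i
      exact I.add_mem (hx i) (hy i)
  · intro h
    rw [pi_eq_sum_univ' c]
    exact Submodule.sum_mem _ fun i _ => Submodule.smul_mem_smul (h i) trivial

lemma length_pi_smul (I : Ideal R) (n : ℕ) :
    Module.length R (I • (⊤ : Submodule R (Fin n → R)) : Submodule R (Fin n → R)) =
      n * Module.length R I := by
  let e : (I • (⊤ : Submodule R (Fin n → R)) : Submodule R (Fin n → R)) ≃ₗ[R] (Fin n → I) :=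
    { toFun := fun c i => ⟨c.1 i, (mem_pi_iff I c.1).mp c.2 i⟩
      invFun := fun c => ⟨fun i => (c i).1, (mem_pi_iff I _).mpr fun i => (c i).2⟩
      map_add' := fun _ _ => rfl
      map_smul' := fun _ _ => rfl
      left_inv := fun _ => rfl
      right_inv := fun _ => rfl }
  rw [e.length_eq, Module.length_pi]
  simp

variable [IsLocalRing R]

/-- the residue field is killed by the maximal ideal -/
lemma smul_res {a : R} (ha : a ∈ maximalIdeal R) (x : ResidueField R) : a • x = 0 := by
  obtain ⟨y, rfl⟩ := residue_surjective x
  rw [Algebra.smul_def, ResidueField.algebraMap_eq, (residue_eq_zero_iff a).mpr ha, zero_mul]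

lemma hom_res_smul {N : Type} [AddCommGroup N] [Module R N] (φ : N →ₗ[R] ResidueField R)
    {x : N} (hx : x ∈ maximalIdeal R • (⊤ : Submodule R N)) : φ x = 0 := by
  refine Submodule.smul_induction_on hx ?_ ?_
  · intro r hr x _
    rw [map_smul, smul_res hr]
  · intro x y hx hy
    rw [map_add, hx, hy, add_zero]

@[reducible]
noncomputable def resModule (N : Type) [AddCommGroup N] [Module R N] :
    Module (ResidueField R) (N ⧸ maximalIdeal R • (⊤ : Submodule R N)) :=
  inferInstanceAs (Module (R ⧸ maximalIdeal R) (N ⧸ maximalIdeal R • (⊤ : Submodule R N)))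

lemma resTower (N : Type) [AddCommGroup N] [Module R N] :
    letI := resModule (R := R) N
    IsScalarTower R (ResidueField R) (N ⧸ maximalIdeal R • (⊤ : Submodule R N)) :=
  inferInstanceAs (IsScalarTower R (R ⧸ maximalIdeal R)
    (N ⧸ maximalIdeal R • (⊤ : Submodule R N)))

lemma exists_functional {N : Type} [AddCommGroup N] [Module R N] {y : N}
    (hy : y ∉ maximalIdeal R • (⊤ : Submodule R N)) :
    ∃ φ : N →ₗ[R] ResidueField R, φ y = 1 := by
  let V := N ⧸ maximalIdeal R • (⊤ : Submodule R N)
  let _ : Module (ResidueField R) V := resModule N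
  have _ : IsScalarTower R (ResidueField R) V := resTower N
  let q : N →ₗ[R] V := Submodule.mkQ _
  have h1 : q y ≠ 0 := fun h => hy ((Submodule.Quotient.mk_eq_zero _).mp h)
  have h2 : ¬ ∀ φ : Module.Dual (ResidueField R) V, φ (q y) = 0 := fun h =>
    h1 ((Module.forall_dual_apply_eq_zero_iff (ResidueField R) (q y)).mp h)
  push Not at h2
  obtain ⟨φ, hφ⟩ := h2
  refine ⟨(((φ (q y))⁻¹ • φ).restrictScalars R) ∘ₗ q, ?_⟩
  change (φ (q y))⁻¹ * φ (q y) = 1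
  exact inv_mul_cancel₀ hφ

lemma exists_cover (N : Type) [AddCommGroup N] [Module R N] [Module.Finite R N] :
    ∃ (n : ℕ) (f : (Fin n → R) →ₗ[R] N), Function.Surjective f ∧
      LinearMap.ker f ≤ maximalIdeal R • (⊤ : Submodule R (Fin n → R)) ∧
      Module.length R (N ⧸ maximalIdeal R • (⊤ : Submodule R N)) = n := by
  let V := N ⧸ maximalIdeal R • (⊤ : Submodule R N)
  let _ : Module (ResidueField R) V := resModule N
  have _ : IsScalarTower R (ResidueField R) V := resTower N
  have : Module.Finite (ResidueField R) V := Module.Finite.of_restrictScalars_finite R _ _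
  let q : N →ₗ[R] V := Submodule.mkQ _
  have hq : Function.Surjective q := Submodule.mkQ_surjective _
  let b := Module.finBasis (ResidueField R) V
  choose v hv using fun i => hq (b i)
  let n := Module.finrank (ResidueField R) V
  let f : (Fin n → R) →ₗ[R] N := Fintype.linearCombination R v
  have hqf : ∀ c : Fin n → R, q (f c) = ∑ i, residue R (c i) • b i := by
    intro c
    simp only [f, Fintype.linearCombination_apply, map_sum, map_smul, hv]
    refine Finset.sum_congr rfl fun i _ => ?_
    rw [← ResidueField.algebraMap_eq, algebraMap_smul]
  refine ⟨n, f, ?_, ?_, ?_⟩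
  · rw [← LinearMap.range_eq_top, ← IsLocalRing.map_mkQ_eq_top]
    rw [eq_top_iff]
    intro x _
    choose c hc using fun i => residue_surjective (b.repr x i)
    refine ⟨f c, ⟨c, rfl⟩, ?_⟩
    refine (hqf c).trans ?_
    simp only [hc]
    exact b.sum_repr x
  · intro c hc
    rw [mem_pi_iff]
    intro i
    have h := hqf c
    rw [LinearMap.mem_ker.mp hc, map_zero] at h
    have := Fintype.linearIndependent_iff.mp b.linearIndependent (fun i => residue R (c i)) h.symm i
    exact (residue_eq_zero_iff _).mp this
  · have := isSimple R
    rw [(b.equivFun.restrictScalars R).length_eq, Module.length_pi, Module.length_eq_one]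
    simp [n]

lemma betti_zero (N : Type) [AddCommGroup N] [Module R N] {n : ℕ} (f : (Fin n → R) →ₗ[R] N)
    (hf : Function.Surjective f)
    (hk : LinearMap.ker f ≤ maximalIdeal R • (⊤ : Submodule R (Fin n → R))) :
    bettiNum R N 0 = n := by
  rw [bettiNum, moduleLength_eq, (ext0 R N (ResidueField R)).length_eq]
  let e : (N →ₗ[R] ResidueField R) ≃ₗ[R] ((Fin n → R) →ₗ[R] ResidueField R) :=
    LinearEquiv.ofBijective (LinearMap.lcomp R (ResidueField R) f) (by
      constructor
      · intro a b hab
        ext x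
        obtain ⟨y, rfl⟩ := hf x
        exact LinearMap.congr_fun hab y
      · intro g
        have hg : LinearMap.ker f ≤ LinearMap.ker g := fun x hx => hom_res_smul g (hk hx)
        refine ⟨(LinearMap.ker f).liftQ g hg ∘ₗ (f.quotKerEquivOfSurjective hf).symm.toLinearMap, ?_⟩
        apply LinearMap.ext
        intro x
        have : f.quotKerEquivOfSurjective hf (Submodule.Quotient.mk x) = f x := rfl
        change (LinearMap.ker f).liftQ g hg ((f.quotKerEquivOfSurjective hf).symm (f x)) = g x
        rw [← this, LinearEquiv.symm_apply_apply]
        rfl)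
  have := isSimple R
  rw [e.length_eq, ← ((Pi.basisFun R (Fin n)).constr R).length_eq, Module.length_pi,
    Module.length_eq_one]
  simp

lemma betti_succ (N : Type) [AddCommGroup N] [Module R N] {n : ℕ} (f : (Fin n → R) →ₗ[R] N)
    (hf : Function.Surjective f)
    (hk : LinearMap.ker f ≤ maximalIdeal R • (⊤ : Submodule R (Fin n → R))) (i : ℕ) :
    bettiNum R N (i+1) = bettiNum R (LinearMap.ker f) i := by
  rw [bettiNum, bettiNum, moduleLength_eq, moduleLength_eq,
    (extSucc R N (ResidueField R) i).length_eq]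
  cases i with
  | zero =>
    rw [(ext0 R _ (ResidueField R)).length_eq]
    refine (LinearEquiv.length_eq (shiftZero f hf fun g => ?_)).symm
    ext x
    exact hom_res_smul g (hk x.2)
  | succ i =>
    rw [(extSucc R _ (ResidueField R) i).length_eq]
    exact (LinearEquiv.length_eq (shiftEquiv f hf i)).symm

lemma length_eq_betti (N : Type) [AddCommGroup N] [Module R N] [Module.Finite R N] :
    Module.length R N = bettiNum R N 0 +
      Module.length R (maximalIdeal R • (⊤ : Submodule R N) : Submodule R N) := by
  obtain ⟨n, f, hf, hk, hn⟩ := exists_cover (R := R) N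
  rw [betti_zero N f hf hk, ← hn, add_comm]
  exact Module.length_eq_add_of_exact (Submodule.subtype _) (Submodule.mkQ _)
    (Submodule.subtype_injective _) (Submodule.mkQ_surjective _) 
    (LinearMap.exact_subtype_mkQ _)

end loc

section gor
variable {R : Type} [CommRing R] [IsLocalRing R]

/-- The map from the residue field given by an element killed by the maximal ideal. -/
noncomputable def killMap {N : Type} [AddCommGroup N] [Module R N] (y : N)
    (hy : ∀ a ∈ maximalIdeal R, a • y = 0) : ResidueField R →ₗ[R] N :=
  (maximalIdeal R).liftQ (LinearMap.toSpanSingleton R N y) (fun a ha => hy a ha)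

lemma killMap_residue {N : Type} [AddCommGroup N] [Module R N] (y : N)
    (hy : ∀ a ∈ maximalIdeal R, a • y = 0) (a : R) : killMap y hy (residue R a) = a • y := rfl

lemma killMap_one {N : Type} [AddCommGroup N] [Module R N] (y : N)
    (hy : ∀ a ∈ maximalIdeal R, a • y = 0) : killMap y hy 1 = y := by
  rw [← map_one (residue R), killMap_residue, one_smul]

lemma mem_socle {x : R} : x ∈ socle R ↔ ∀ a ∈ maximalIdeal R, a * x = 0 := by
  simp only [socle, Submodule.mem_colon, SetLike.mem_coe, smul_eq_mul, Submodule.mem_bot]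
  exact ⟨fun h a ha => by rw [mul_comm]; exact h a ha, fun h a ha => by rw [mul_comm]; exact h a ha⟩

lemma sq_le_socle (h3 : maximalIdeal R ^ 3 = ⊥) : maximalIdeal R ^ 2 ≤ socle R := by
  intro x hx
  rw [mem_socle]
  intro a ha
  have : a * x ∈ maximalIdeal R ^ 3 := by
    rw [pow_succ']
    exact Ideal.mul_mem_mul ha hx
  rwa [h3, Submodule.mem_bot] at this

lemma van_all [IsNoetherianRing R] (h3 : maximalIdeal R ^ 3 = ⊥) (h : ℕ)
    (hE : Subsingleton (E R (ResidueField R) R h)) (N : Type) [AddCommGroup N] [Module R N]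
    [hN : Module.Finite R N] : Subsingleton (E R N R h) := by
  refine IsNoetherianRing.induction_on_isQuotientEquivQuotientPrime R hN
    (motive := fun N _ _ _ => Subsingleton (E R N R h)) ?_ ?_ ?_
  · intro N _ _ _ _
    exact subsingleton_retract (0 : N →ₗ[R] ResidueField R) 0 (Subsingleton.elim _ _) h hE
  · intro N _ _ _ p e
    have hp : p.asIdeal = maximalIdeal R := by
      refine (eq_maximalIdeal ?_)
      have h1 : maximalIdeal R ≤ p.asIdeal := by
        refine p.2.le_of_pow_le (n := 3) ?_
        rw [h3]
        exact bot_le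
      have h2 := (maximalIdeal.isMaximal R).eq_of_le p.2.ne_top h1
      rw [← h2]
      infer_instance
    have e2 : N ≃ₗ[R] ResidueField R := e.trans (Submodule.quotEquivOfEq _ _ hp)
    exact subsingleton_retract e2.toLinearMap e2.symm.toLinearMap
      (LinearMap.ext fun x => e2.symm_apply_apply x) h hE
  · intro N₁ _ _ _ N₂ _ _ _ N₃ _ _ _ f g hf hg hfg h1 h3
    exact subsingleton_exact f g hf hg hfg h h1 h3

lemma descend [IsNoetherianRing R] (h3 : maximalIdeal R ^ 3 = ⊥) (h2 : maximalIdeal R ^ 2 ≠ ⊥) (h : ℕ)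
    (hE : Subsingleton (E R (ResidueField R) R (h+2))) :
    Subsingleton (E R (ResidueField R) R (h+1)) := by
  obtain ⟨a, ha, ha0⟩ := Submodule.exists_mem_ne_zero_of_ne_bot h2
  have has := mem_socle.mp (sq_le_socle h3 ha)
  let f : R →ₗ[R] R ⧸ Ideal.span {a} := Submodule.mkQ _
  have hker : LinearMap.ker f = Ideal.span {a} := Submodule.ker_mkQ _
  have haf : a ∈ LinearMap.ker f := by rw [hker]; exact Ideal.mem_span_singleton_self a
  have h1 : Subsingleton (E R (LinearMap.ker f) R (h+1)) :=
    (shiftEquiv f (Submodule.mkQ_surjective _) h).toEquiv.subsingleton_congr.mpr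
      (van_all h3 (h+2) hE _)
  let i : ResidueField R →ₗ[R] LinearMap.ker f := killMap ⟨a, haf⟩ fun b hb => Subtype.ext (has b hb)
  have hi : Function.Bijective i := by
    constructor
    · have := isSimple R
      refine LinearMap.injective_of_ne_zero fun h0 => ha0 ?_
      have := LinearMap.congr_fun h0 1
      rw [show i 1 = _ from killMap_one _ _] at this
      exact congrArg Subtype.val this
    · rintro ⟨x, hx⟩
      rw [hker] at hx
      obtain ⟨c, rfl⟩ := Ideal.mem_span_singleton'.mp hx
      exact ⟨residue R c, rfl⟩
  let e := LinearEquiv.ofBijective i hi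
  exact subsingleton_retract e.toLinearMap e.symm.toLinearMap
      (LinearMap.ext fun x => e.symm_apply_apply x) _ h1

lemma one_absurd [IsNoetherianRing R] (h3 : maximalIdeal R ^ 3 = ⊥) (h2 : maximalIdeal R ^ 2 ≠ ⊥)
    (hG : 2 ≤ socdim R) (hE : Subsingleton (E R (ResidueField R) R 1)) : False := by
  obtain ⟨a, ha, ha0⟩ := Submodule.exists_mem_ne_zero_of_ne_bot h2
  have haS := sq_le_socle h3 ha
  have has := mem_socle.mp haS
  let a' : socle R := ⟨a, haS⟩
  let i : ResidueField R →ₗ[R] socle R := killMap a' fun b hb => Subtype.ext (has b hb)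
  have hns : ¬ Function.Surjective i := by
    intro hs
    have := Module.length_le_of_surjective i hs
    have _ := isSimple R
    have h1 : Module.length R (ResidueField R) = 1 := Module.length_eq_one R _
    rw [h1, ← moduleLength_eq] at this
    have h : (2 : ℕ∞) ≤ 1 := hG.trans this
    norm_num at h
  obtain ⟨b, hb⟩ := not_forall.mp hns
  let Q := socle R ⧸ LinearMap.range i
  let q : socle R →ₗ[R] Q := Submodule.mkQ _
  have hbQ : q b ∉ maximalIdeal R • (⊤ : Submodule R Q) := by
    have : maximalIdeal R • (⊤ : Submodule R Q) = ⊥ := by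
      rw [eq_bot_iff, Submodule.smul_le]
      intro c hc x _
      obtain ⟨y, rfl⟩ := Submodule.mkQ_surjective _ x
      rw [← map_smul, show c • y = 0 from Subtype.ext (mem_socle.mp y.2 c hc), map_zero]
      exact Submodule.zero_mem _
    rw [this, Submodule.mem_bot]
    intro h
    exact hb (LinearMap.mem_range.mp ((Submodule.Quotient.mk_eq_zero _).mp h))
  obtain ⟨ψ, hψ⟩ := exists_functional hbQ
  let j : ResidueField R →ₗ[R] R := killMap a has
  let f : R →ₗ[R] R ⧸ socle R := Submodule.mkQ _
  have hker : LinearMap.ker f = socle R := Submodule.ker_mkQ _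
  let e := LinearEquiv.ofEq _ _ hker
  obtain ⟨g, hg⟩ := extend_of_subsingleton f (Submodule.mkQ_surjective _)
    (van_all h3 1 hE _) (j ∘ₗ ψ ∘ₗ q ∘ₗ e.toLinearMap)
  have hg' : ∀ x : socle R, j (ψ (q x)) = x.1 * g 1 := by
    intro x
    have := LinearMap.congr_fun hg ⟨x.1, hker.symm ▸ x.2⟩
    have h4 : g x.1 = x.1 * g 1 := by
      rw [← smul_eq_mul, ← map_smul, smul_eq_mul, mul_one]
    rw [← h4]
    exact this
  have hA := hg' a'
  have hB := hg' b
  have hqa : q a' = 0 := (Submodule.Quotient.mk_eq_zero _).mpr ⟨1, killMap_one _ _⟩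
  rw [hqa, map_zero, map_zero] at hA
  rw [hψ, show j 1 = a from killMap_one _ _] at hB
  by_cases hu : IsUnit (g 1)
  · exact ha0 ((hu.mul_left_eq_zero).mp hA.symm)
  · have := mem_socle.mp b.2 (g 1) ((mem_maximalIdeal _).mpr hu)
    rw [mul_comm, ← hB] at this
    exact ha0 this

lemma res_absurd [IsNoetherianRing R] (h3 : maximalIdeal R ^ 3 = ⊥) (h2 : maximalIdeal R ^ 2 ≠ ⊥)
    (hG : 2 ≤ socdim R) (h : ℕ) (hE : Subsingleton (E R (ResidueField R) R (h+1))) : False := by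
  induction h with
  | zero => exact one_absurd h3 h2 hG hE
  | succ h ih => exact ih (descend h3 h2 h hE)

/-- Infinitely many vanishing Ext modules. -/
def Van (R N : Type) [CommRing R] [AddCommGroup N] [Module R N] : Prop :=
  ∀ m : ℕ, ∃ h, m ≤ h ∧ Subsingleton (E R N R (h+1))

lemma no_summand [IsNoetherianRing R] (h3 : maximalIdeal R ^ 3 = ⊥) (h2 : maximalIdeal R ^ 2 ≠ ⊥)
    (hG : 2 ≤ socdim R) {N : Type} [AddCommGroup N] [Module R N] (hV : Van R N) (y : N)
    (hy : ∀ a ∈ maximalIdeal R, a • y = 0) : y ∈ maximalIdeal R • (⊤ : Submodule R N) := by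
  by_contra hc
  obtain ⟨φ, hφ⟩ := exists_functional hc
  obtain ⟨h, -, hE⟩ := hV 0
  refine res_absurd h3 h2 hG h (subsingleton_retract (killMap y hy) φ ?_ _ hE)
  apply LinearMap.ext
  intro x
  obtain ⟨a, rfl⟩ := residue_surjective x
  rw [LinearMap.comp_apply, killMap_residue, map_smul, hφ]
  rw [Algebra.smul_def, mul_one]
  rfl

lemma van_ker {N : Type} [AddCommGroup N] [Module R N] (hV : Van R N) {n : ℕ}
    (f : (Fin n → R) →ₗ[R] N) (hf : Function.Surjective f) : Van R (LinearMap.ker f) := by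
  intro m
  obtain ⟨h, hm, hE⟩ := hV (m+1)
  obtain ⟨h, rfl⟩ : ∃ h', h = h' + 1 := ⟨h - 1, by omega⟩
  exact ⟨h, by omega, (shiftEquiv f hf h).toEquiv.subsingleton_congr.mpr hE⟩

variable {N : Type} [AddCommGroup N] [Module R N]

lemma sq_le_ker (hN : maximalIdeal R ^ 2 • (⊤ : Submodule R N) = ⊥) {n : ℕ}
    (f : (Fin n → R) →ₗ[R] N) :
    maximalIdeal R ^ 2 • (⊤ : Submodule R (Fin n → R)) ≤ LinearMap.ker f := by
  rw [Submodule.smul_le]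
  intro r hr x _
  rw [LinearMap.mem_ker, map_smul, ← Submodule.mem_bot R, ← hN]
  exact Submodule.smul_mem_smul hr trivial

lemma smul_ker_le {n : ℕ} (f : (Fin n → R) →ₗ[R] N)
    (hk : LinearMap.ker f ≤ maximalIdeal R • (⊤ : Submodule R (Fin n → R))) :
    maximalIdeal R • LinearMap.ker f ≤ maximalIdeal R ^ 2 • (⊤ : Submodule R (Fin n → R)) := by
  rw [pow_two, Submodule.mul_smul]
  exact Submodule.smul_mono le_rfl hk

lemma sq_smul_ker (h3 : maximalIdeal R ^ 3 = ⊥) {n : ℕ} (f : (Fin n → R) →ₗ[R] N)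
    (hk : LinearMap.ker f ≤ maximalIdeal R • (⊤ : Submodule R (Fin n → R))) :
    maximalIdeal R ^ 2 • (⊤ : Submodule R (LinearMap.ker f)) = ⊥ := by
  rw [eq_bot_iff]
  intro x hx
  rw [Submodule.mem_smul_top_iff] at hx
  have h1 := Submodule.smul_mono (le_refl (maximalIdeal R ^ 2)) hk hx
  rw [← Submodule.mul_smul, ← pow_succ, h3, Submodule.bot_smul] at h1
  exact Subtype.ext h1

lemma smul_ker_eq [IsNoetherianRing R] (h3 : maximalIdeal R ^ 3 = ⊥)
    (h2 : maximalIdeal R ^ 2 ≠ ⊥) (hG : 2 ≤ socdim R) (hV : Van R N)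
    (hN : maximalIdeal R ^ 2 • (⊤ : Submodule R N) = ⊥) {n : ℕ}
    (f : (Fin n → R) →ₗ[R] N) (hf : Function.Surjective f)
    (hk : LinearMap.ker f ≤ maximalIdeal R • (⊤ : Submodule R (Fin n → R))) :
    maximalIdeal R • LinearMap.ker f = maximalIdeal R ^ 2 • (⊤ : Submodule R (Fin n → R)) := by
  refine le_antisymm (smul_ker_le f hk) fun y hy => ?_
  have hyk := sq_le_ker hN f hy
  have := no_summand h3 h2 hG (van_ker hV f hf) ⟨y, hyk⟩ (fun a ha => ?_)
  · exact (Submodule.mem_smul_top_iff _ _ _).mp this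
  · apply Subtype.ext
    have h1 := Submodule.smul_mem_smul ha hy
    rw [← Submodule.mul_smul, ← pow_succ', h3, Submodule.bot_smul] at h1
    exact h1

lemma length_smul_top (I : Ideal R) (K : Submodule R N) :
    Module.length R (I • (⊤ : Submodule R K) : Submodule R K) =
      Module.length R (I • K : Submodule R N) := by
  have h : Submodule.map K.subtype (I • ⊤) = I • K := by
    rw [Submodule.map_smul'', Submodule.map_top, Submodule.range_subtype]
  rw [← h]
  exact (Submodule.equivMapOfInjective K.subtype K.subtype_injective (I • ⊤)).length_eq

lemma length_max : Module.length R (maximalIdeal R) =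
    embdim R + Module.length R (maximalIdeal R ^ 2 : Ideal R) := by
  have h1 : Module.length R (maximalIdeal R • (⊤ : Submodule R (maximalIdeal R)) :
      Submodule R (maximalIdeal R)) = Module.length R (maximalIdeal R ^ 2 : Ideal R) := by
    rw [length_smul_top, pow_two]
    rfl
  rw [embdim, moduleLength_eq, ← h1, add_comm]
  exact Module.length_eq_add_of_exact (Submodule.subtype _) (Submodule.mkQ _)
    (Submodule.subtype_injective _) (Submodule.mkQ_surjective _) 
    (LinearMap.exact_subtype_mkQ _)

lemma first_eq [IsNoetherianRing R] (h3 : maximalIdeal R ^ 3 = ⊥)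
    (h2 : maximalIdeal R ^ 2 ≠ ⊥) (hG : 2 ≤ socdim R) [Module.Finite R N] (hV : Van R N)
    (hN : maximalIdeal R ^ 2 • (⊤ : Submodule R N) = ⊥) :
    bettiNum R N 1 + Module.length R (maximalIdeal R • (⊤ : Submodule R N) : Submodule R N) =
      embdim R * bettiNum R N 0 := by
  obtain ⟨n, f, hf, hk, -⟩ := exists_cover (R := R) N
  have hart : IsArtinianRing R := by
    rw [isArtinianRing_iff_isNilpotent_maximalIdeal]
    exact ⟨3, h3⟩
  have hb0 := betti_zero N f hf hk
  have hb1 := betti_succ N f hf hk 0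
  have hLK := length_eq_betti (R := R) (LinearMap.ker f)
  rw [length_smul_top, smul_ker_eq h3 h2 hG hV hN f hf hk, length_pi_smul, ← hb1] at hLK
  -- the exact sequence 0 → K → mF → mN → 0
  have hmap : Submodule.map f (maximalIdeal R • ⊤) = maximalIdeal R • (⊤ : Submodule R N) := by
    rw [Submodule.map_smul'', Submodule.map_top, LinearMap.range_eq_top.mpr hf]
  have hex : Module.length R (maximalIdeal R • (⊤ : Submodule R (Fin n → R)) :
      Submodule R (Fin n → R)) = Module.length R (LinearMap.ker f) +
      Module.length R (maximalIdeal R • (⊤ : Submodule R N) : Submodule R N) := by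
    let g : (maximalIdeal R • (⊤ : Submodule R (Fin n → R)) : Submodule R (Fin n → R)) →ₗ[R]
      (maximalIdeal R • (⊤ : Submodule R N) : Submodule R N) :=
      f.restrict fun x hx => hmap ▸ Submodule.mem_map_of_mem hx
    refine Module.length_eq_add_of_exact (Submodule.inclusion hk) g
      (Submodule.inclusion_injective hk) ?_ ?_
    · rintro ⟨y, hy⟩
      rw [← hmap] at hy
      obtain ⟨x, hx, rfl⟩ := hy
      exact ⟨⟨x, hx⟩, rfl⟩
    · rintro ⟨x, hx⟩
      constructor
      · intro h
        exact ⟨⟨x, congrArg Subtype.val h⟩, rfl⟩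
      · rintro ⟨y, hy⟩
        apply Subtype.ext
        have : y.1 = x := congrArg Subtype.val hy
        change f x = 0
        rw [← this]
        exact y.2
  rw [length_pi_smul, length_max, hLK, mul_add] at hex
  have hfin : (n : ℕ∞) * Module.length R (maximalIdeal R ^ 2 : Ideal R) ≠ ⊤ :=
    WithTop.mul_ne_top (ENat.natCast_ne_top n) Module.length_ne_top
  rw [hb0, mul_comm]
  rw [add_right_comm] at hex
  exact (ENat.add_left_injective_of_ne_top hfin hex).symm

lemma second_eq [IsNoetherianRing R] (h3 : maximalIdeal R ^ 3 = ⊥)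
    (h2 : maximalIdeal R ^ 2 ≠ ⊥) (hG : 2 ≤ socdim R) (i : ℕ) :
    ∀ (N : Type) [AddCommGroup N] [Module R N] [Module.Finite R N], Van R N →
    maximalIdeal R ^ 2 • (⊤ : Submodule R N) = ⊥ →
    bettiNum R N (i+2) + Module.length R (maximalIdeal R ^ 2 : Ideal R) * bettiNum R N i =
      embdim R * bettiNum R N (i+1) := by
  induction i with
  | zero =>
    intro N _ _ _ hV hN
    obtain ⟨n, f, hf, hk, -⟩ := exists_cover (R := R) N
    have h := first_eq h3 h2 hG (van_ker hV f hf) (sq_smul_ker h3 f hk)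
    rw [length_smul_top, smul_ker_eq h3 h2 hG hV hN f hf hk, length_pi_smul,
      ← betti_succ N f hf hk, ← betti_succ N f hf hk, mul_comm (n : ℕ∞)] at h
    rw [betti_zero N f hf hk]
    exact h
  | succ i ih =>
    intro N _ _ _ hV hN
    obtain ⟨n, f, hf, hk, -⟩ := exists_cover (R := R) N
    have h := ih (LinearMap.ker f) (van_ker hV f hf) (sq_smul_ker h3 f hk)
    rw [← betti_succ N f hf hk, ← betti_succ N f hf hk, ← betti_succ N f hf hk] at h
    exact h

lemma socle_eq [IsNoetherianRing R] (h3 : maximalIdeal R ^ 3 = ⊥)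
    (h2 : maximalIdeal R ^ 2 ≠ ⊥) (hG : 2 ≤ socdim R) [Module.Finite R N] [Nontrivial N]
    (hV : Van R N) (hN : maximalIdeal R ^ 2 • (⊤ : Submodule R N) = ⊥) :
    socle R = maximalIdeal R ^ 2 := by
  refine le_antisymm (fun x hx => ?_) (sq_le_socle h3)
  have hxs := mem_socle.mp hx
  obtain ⟨n, f, hf, hk, -⟩ := exists_cover (R := R) N
  have hVK := van_ker hV f hf
  have hn : 0 < n := by
    rcases Nat.eq_zero_or_pos n with rfl | h
    · exact absurd hf.subsingleton (not_subsingleton N)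
    · exact h
  obtain ⟨n1, f1, hf1, hk1, -⟩ := exists_cover (R := R) (LinearMap.ker f)
  have hn1 : 0 < n1 := by
    rcases Nat.eq_zero_or_pos n1 with rfl | h
    · exfalso
      have hs : Subsingleton (LinearMap.ker f) := hf1.subsingleton
      obtain ⟨a, ha, ha0⟩ := Submodule.exists_mem_ne_zero_of_ne_bot h2
      have hmem : a • (Pi.single ⟨0, hn⟩ 1 : Fin n → R) ∈ LinearMap.ker f :=
        sq_le_ker hN f (Submodule.smul_mem_smul ha trivial)
      have h0 : a • (Pi.single ⟨0, hn⟩ 1 : Fin n → R) = 0 :=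
        congrArg Subtype.val (@Subsingleton.elim _ hs ⟨_, hmem⟩ 0)
      have := congrFun h0 ⟨0, hn⟩
      simp at this
      exact ha0 this
    · exact h
  let v : Fin n1 → R := Pi.single ⟨0, hn1⟩ 1
  have hmem : x • v ∈ LinearMap.ker f1 := by
    rw [LinearMap.mem_ker, map_smul]
    apply Subtype.ext
    funext i
    exact (mul_comm _ _).trans (hxs _ ((mem_pi_iff _ _).mp (hk (f1 v).2) i))
  have h1 := no_summand h3 h2 hG (van_ker hVK f1 hf1) ⟨x • v, hmem⟩ (fun a ha => by
    apply Subtype.ext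
    change a • x • v = 0
    rw [smul_smul, hxs a ha, zero_smul])
  rw [Submodule.mem_smul_top_iff] at h1
  have h4 := (mem_pi_iff _ _).mp (smul_ker_le f1 hk1 h1) ⟨0, hn1⟩
  simpa [v] using h4

end gor

end Exc

/-- Let `(R, m, k)` be a local ring with `m³ = 0 ≠ m²` which is not Gorenstein
(equivalently, `r ≥ 2`).  If `M` is a nonzero finitely generated `R`-module with
`m²M = 0` and `Ext^h_R(M, R) = 0` for infinitely many `h ≥ 1`, then `(0 :_R m) = m²`,
`β₁(M) = e·β₀(M) − dim_k(mM)` and `β_i(M) = e·β_{i−1}(M) − r·β_{i−2}(M)` for all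
`i ≥ 2` (the displayed equalities are stated in rearranged, subtraction-free form);
that is, `M` is exceptional. -/
theorem exceptional (R : Type) [CommRing R] [IsNoetherianRing R] [IsLocalRing R]
    (h3 : maximalIdeal R ^ 3 = ⊥) (h2 : maximalIdeal R ^ 2 ≠ ⊥)
    (hnotGor : 2 ≤ socdim R)
    (M : Type) [AddCommGroup M] [Module R M] [Module.Finite R M] [Nontrivial M]
    (hM : maximalIdeal R ^ 2 • (⊤ : Submodule R M) = ⊥)
    (hext : {h : ℕ | 1 ≤ h ∧ Subsingleton (extModule R M R h).carrier}.Infinite) :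
    socle R = maximalIdeal R ^ 2 ∧
    bettiNum R M 1 + moduleLength R (↥(maximalIdeal R • (⊤ : Submodule R M)))
      = embdim R * bettiNum R M 0 ∧
    ∀ i : ℕ, 2 ≤ i →
      bettiNum R M i + socdim R * bettiNum R M (i - 2) = embdim R * bettiNum R M (i - 1) := by
  have hV : Exc.Van R M := by
    intro m
    obtain ⟨h, ⟨h1, hs⟩, hm⟩ := hext.exists_gt m
    obtain ⟨h, rfl⟩ : ∃ h', h = h' + 1 := ⟨h - 1, by omega⟩
    exact ⟨h, by omega, (Exc.extSucc R M R h).toEquiv.subsingleton_congr.mp hs⟩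
  have hs := Exc.socle_eq h3 h2 hnotGor hV hM
  refine ⟨hs, ?_, ?_⟩
  · rw [Exc.moduleLength_eq]
    exact Exc.first_eq h3 h2 hnotGor hV hM
  · intro i hi
    obtain ⟨i, rfl⟩ : ∃ j, i = j + 2 := ⟨i - 2, by omega⟩
    have h := Exc.second_eq h3 h2 hnotGor i M hV hM
    rw [← hs, ← Exc.moduleLength_eq] at h
    exact h
end

section
/- Let M be a finitely generated R-module with m²M = 0 and Ext^1_R(M, R) = 0. Then ℓ_R(Hom_R(M, R)) = r·ℓ_R(M) − dim_k(M/mM)·μ^1_R, where μ^1_R = dim_k Ext^1_R(k, R). -/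
open IsLocalRing CategoryTheory

/-- Homology of a short complex of modules from a parametrization of cycles. -/
theorem homology_param {R : Type} [CommRing R] (S : ShortComplex (ModuleCat.{0} R))
    (A : Type) [AddCommGroup A] [Module R A] (j : A →ₗ[R] S.X₂)
    (hr : LinearMap.range j = LinearMap.ker S.g.hom) :
    ∃ δ : A →ₗ[R] S.homology, Function.Surjective δ ∧
      ∀ a, δ a = 0 ↔ ∃ x, S.f.hom x = j a := by
  let e := S.moduleCatHomologyIso.toLinearEquiv
  have hmem : ∀ a, j a ∈ LinearMap.ker S.g.hom := fun a => hr ▸ LinearMap.mem_range_self j a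
  let j' : A →ₗ[R] LinearMap.ker S.g.hom := j.codRestrict _ hmem
  let q : LinearMap.ker S.g.hom →ₗ[R]
      (LinearMap.ker S.g.hom ⧸ LinearMap.range S.moduleCatToCycles) :=
    (LinearMap.range S.moduleCatToCycles).mkQ
  refine ⟨e.symm.toLinearMap ∘ₗ (q ∘ₗ j'), ?_, ?_⟩
  · have h1 : Function.Surjective (q ∘ₗ j') := by
      intro y
      obtain ⟨⟨z, hz⟩, rfl⟩ := Submodule.mkQ_surjective _ y
      obtain ⟨a, ha⟩ : z ∈ LinearMap.range j := hr ▸ hz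
      exact ⟨a, congrArg q (Subtype.ext ha)⟩
    exact e.symm.surjective.comp h1
  · intro a
    have h2 : (e.symm.toLinearMap ∘ₗ (q ∘ₗ j')) a = 0 ↔ q (j' a) = 0 :=
      e.symm.map_eq_zero_iff
    rw [h2]
    have h3 : q (j' a) = 0 ↔ j' a ∈ LinearMap.range S.moduleCatToCycles :=
      Submodule.Quotient.mk_eq_zero _
    rw [h3]
    constructor
    · rintro ⟨x, hx⟩
      exact ⟨x, congrArg Subtype.val hx⟩
    · rintro ⟨x, hx⟩
      exact ⟨x, Subtype.ext hx⟩

section res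
variable {R : Type} [CommRing R] {M P : Type} [AddCommGroup M] [Module R M]
  [AddCommGroup P] [Module R P] (p : P →ₗ[R] M)

/-- chosen resolution of the kernel -/
noncomputable def kerRes : ProjectiveResolution (ModuleCat.of R (LinearMap.ker p)) :=
  projectiveResolution _

/-- the augmentation of the resolution of the kernel -/
noncomputable def kerResπ : (kerRes p).complex.X 0 ⟶ ModuleCat.of R (LinearMap.ker p) :=
  (kerRes p).π.f 0

theorem kerRes_w : (kerRes p).complex.d 1 0 ≫ kerResπ p = 0 :=
  (kerRes p).complex_d_comp_π_f_zero

theorem kerResπ_surj : Function.Surjective (kerResπ p).hom := by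
  have : Epi (kerResπ p) := inferInstanceAs (Epi ((kerRes p).π.f 0))
  exact (ModuleCat.epi_iff_surjective _).1 this

theorem kerRes_exact₀ (x : (kerRes p).complex.X 0) (hx : (kerResπ p).hom x = 0) :
    ∃ y, ((kerRes p).complex.d 1 0).hom y = x :=
  (ShortComplex.moduleCat_exact_iff _).1 (kerRes p).exact₀ x hx

/-- inclusion of kernel -/
noncomputable def kerInc : ModuleCat.of R (LinearMap.ker p) ⟶ ModuleCat.of R P :=
  ModuleCat.ofHom (LinearMap.ker p).subtype

/-- spliced complex -/
noncomputable def splice : ChainComplex (ModuleCat.{0} R) ℕ :=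
  (kerRes p).complex.augment (kerResπ p ≫ kerInc p)
    (by rw [← Category.assoc, kerRes_w, Limits.zero_comp])

theorem splice_exactAt (n : ℕ) : (splice p).ExactAt (n + 1) := by
  rw [HomologicalComplex.exactAt_iff' _ (n + 1 + 1) (n + 1) n (by simp) (by simp)]
  match n with
  | 0 =>
    rw [ShortComplex.moduleCat_exact_iff]
    intro x hx
    exact kerRes_exact₀ p x (Subtype.ext hx)
  | n + 1 =>
    exact (kerRes p).exact_succ n

/-- resolution starting with a given surjection -/
noncomputable def spliceRes [Module.Projective R P] (hp : Function.Surjective p) :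
    ProjectiveResolution (ModuleCat.of R M) where
  complex := splice p
  projective n := by
    match n with
    | 0 => exact (IsProjective.iff_projective P).1 ‹_›
    | n + 1 => exact (kerRes p).projective n
  π := (ChainComplex.toSingle₀Equiv _ _).symm ⟨ModuleCat.ofHom p, by
    change (kerResπ p ≫ kerInc p) ≫ ModuleCat.ofHom p = 0
    ext x
    exact ((kerResπ p).hom x).2⟩
  quasiIso := ⟨fun n => by
    cases n
    · rw [ChainComplex.quasiIsoAt₀_iff, ShortComplex.quasiIso_iff_of_zeros']
      · constructor
        · rw [ShortComplex.moduleCat_exact_iff]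
          intro x hx
          obtain ⟨y, hy⟩ := kerResπ_surj p ⟨x, hx⟩
          exact ⟨y, congrArg Subtype.val hy⟩
        · exact (ModuleCat.epi_iff_surjective (ModuleCat.ofHom p)).2 hp
      all_goals rfl
    · rw [quasiIsoAt_iff_exactAt']
      · apply splice_exactAt
      · apply ChainComplex.exactAt_succ_single_obj⟩

theorem ext_param [Module.Projective R P] (hp : Function.Surjective p)
    (N : Type) [AddCommGroup N] [Module R N] :
    ∃ δ : (LinearMap.ker p →ₗ[R] N) →ₗ[R] (extModule R M N 1).carrier,
      Function.Surjective δ ∧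
      ∀ a, δ a = 0 ↔ ∃ g : P →ₗ[R] N, g ∘ₗ (LinearMap.ker p).subtype = a := by
  let Y := ((spliceRes p hp).complex.linearYonedaObj R (ModuleCat.of R N))
  let S := Y.sc' 0 1 2
  let e1 : extModule R M N 1 ≅ S.homology :=
    (spliceRes p hp).isoExt 1 (ModuleCat.of R N) ≪≫
      ShortComplex.homologyMapIso (Y.isoSc' 0 1 2 (by simp) (by simp))
  let j : (LinearMap.ker p →ₗ[R] N) →ₗ[R] S.X₂ :=
    { toFun := fun f => (show (kerRes p).complex.X 0 ⟶ ModuleCat.of R N from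
        kerResπ p ≫ ModuleCat.ofHom f)
      map_add' := fun f g => rfl
      map_smul' := fun r f => rfl }
  have hj : LinearMap.range j = LinearMap.ker S.g.hom := by
    apply le_antisymm
    · rintro _ ⟨f, rfl⟩
      change (kerRes p).complex.d 1 0 ≫ (kerResπ p ≫ ModuleCat.ofHom f) = 0
      rw [← Category.assoc, kerRes_w, Limits.zero_comp]
    · intro x hx
      let x' : (kerRes p).complex.X 0 ⟶ ModuleCat.of R N := x
      have hx' : (kerRes p).complex.d 1 0 ≫ x' = 0 := hx
      have hker : LinearMap.ker (kerResπ p).hom ≤ LinearMap.ker x'.hom := by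
        intro y hy
        obtain ⟨z, rfl⟩ := kerRes_exact₀ p y hy
        exact congrArg (fun t => t.hom z) hx'
      let f : LinearMap.ker p →ₗ[R] N :=
        ((LinearMap.ker (kerResπ p).hom).liftQ x'.hom hker) ∘ₗ
          ((kerResπ p).hom.quotKerEquivOfSurjective (kerResπ_surj p)).symm.toLinearMap
      refine ⟨f, ?_⟩
      change kerResπ p ≫ ModuleCat.ofHom f = x'
      ext y
      change f ((kerResπ p).hom y) = x'.hom y
      have h5 : ((kerResπ p).hom.quotKerEquivOfSurjective (kerResπ_surj p)).symm
          ((kerResπ p).hom y) = Submodule.Quotient.mk y := by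
        rw [LinearEquiv.symm_apply_eq]
        rfl
      change (LinearMap.ker (kerResπ p).hom).liftQ x'.hom hker
        (((kerResπ p).hom.quotKerEquivOfSurjective (kerResπ_surj p)).symm
          ((kerResπ p).hom y)) = x'.hom y
      rw [h5]
      rfl
  obtain ⟨δ, h1, h2⟩ := homology_param S _ j hj
  refine ⟨e1.toLinearEquiv.symm.toLinearMap ∘ₗ δ, e1.toLinearEquiv.symm.surjective.comp h1, ?_⟩
  intro a
  have h3 : (e1.toLinearEquiv.symm.toLinearMap ∘ₗ δ) a = 0 ↔ δ a = 0 :=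
    e1.toLinearEquiv.symm.map_eq_zero_iff
  rw [h3, h2]
  constructor
  · rintro ⟨x, hx⟩
    let x' : ModuleCat.of R P ⟶ ModuleCat.of R N := x
    have hx' : (kerResπ p ≫ kerInc p) ≫ x' = kerResπ p ≫ ModuleCat.ofHom a := hx
    refine ⟨x'.hom, ?_⟩
    ext z
    obtain ⟨y, rfl⟩ := kerResπ_surj p z
    exact congrArg (fun t => t.hom y) hx'
  · rintro ⟨g, rfl⟩
    exact ⟨(show ModuleCat.of R P ⟶ ModuleCat.of R N from ModuleCat.ofHom g), rfl⟩
end res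

section len
variable {R : Type} [CommRing R]

theorem length_hom_ext {M P : Type} [AddCommGroup M] [Module R M]
    [AddCommGroup P] [Module R P] (p : P →ₗ[R] M)
    [Module.Projective R P] (hp : Function.Surjective p)
    (N : Type) [AddCommGroup N] [Module R N] :
    Module.length R (P →ₗ[R] N) + Module.length R (extModule R M N 1).carrier
      = Module.length R (M →ₗ[R] N) + Module.length R (LinearMap.ker p →ₗ[R] N) := by
  obtain ⟨δ, h1, h2⟩ := ext_param p hp N
  let res : (P →ₗ[R] N) →ₗ[R] (LinearMap.ker p →ₗ[R] N) :=
    (LinearMap.ker p).subtype.lcomp R N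
  have e1 : Module.length R (P →ₗ[R] N)
      = Module.length R (M →ₗ[R] N) + Module.length R (LinearMap.range res) := by
    refine Module.length_eq_add_of_exact (p.lcomp R N) res.rangeRestrict
      (LinearMap.lcomp_injective_of_surjective p hp) res.surjective_rangeRestrict ?_
    have := LinearMap.exact_lcomp_of_exact_of_surjective (N := N) (f := (LinearMap.ker p).subtype)
      (g := p) (LinearMap.exact_subtype_ker_map p) hp
    intro x
    rw [← this x, Subtype.ext_iff]
    rfl
  have e2 : Module.length R (LinearMap.ker p →ₗ[R] N)
      = Module.length R (LinearMap.range res) + Module.length R (extModule R M N 1).carrier := by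
    refine Module.length_eq_add_of_exact (LinearMap.range res).subtype δ
      (Submodule.injective_subtype _) h1 ?_
    intro x
    rw [h2 x]
    constructor
    · rintro ⟨g, hg⟩
      exact ⟨⟨x, g, hg⟩, rfl⟩
    · rintro ⟨⟨_, g, hg⟩, rfl⟩
      exact ⟨g, hg⟩
  rw [e1, e2, add_assoc]

theorem length_hom_pi (n : ℕ) (A N : Type) [AddCommGroup A] [Module R A]
    [AddCommGroup N] [Module R N] :
    Module.length R ((Fin n → A) →ₗ[R] N) = n * Module.length R (A →ₗ[R] N) := by
  rw [← (LinearMap.lsum R (fun _ : Fin n => A) R (M := N)).length_eq,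
    Module.length_pi_of_fintype]
  simp

variable [IsLocalRing R]

theorem exists_equiv_pi (V : Type) [AddCommGroup V] [Module R V] [Module.Finite R V]
    (hV : ∀ x ∈ maximalIdeal R, ∀ v : V, x • v = 0) :
    ∃ n : ℕ, Nonempty (V ≃ₗ[R] (Fin n → ResidueField R)) := by
  have ht : Module.IsTorsionBySet R V (maximalIdeal R : Set R) :=
    fun v a => hV a.1 a.2 v
  let _ : Module (R ⧸ maximalIdeal R) V := ht.module
  let _ : Module (ResidueField R) V := ht.module
  have : IsScalarTower R (ResidueField R) V := ht.isScalarTower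
  have : Module.Finite (ResidueField R) V := Module.Finite.of_restrictScalars_finite R _ _
  exact ⟨_, ⟨(Module.finBasis (ResidueField R) V).equivFun.restrictScalars R⟩⟩

theorem length_residue_s8 : Module.length R (ResidueField R) = 1 := by
  rw [Module.length_eq_one_iff]
  exact (isSimpleModule_iff_isCoatom (m := maximalIdeal R)).2 (maximalIdeal.isMaximal R).out

theorem length_pi_residue (n : ℕ) : Module.length R (Fin n → ResidueField R) = n := by
  rw [Module.length_pi_of_fintype]
  simp [length_residue_s8]

theorem length_hom_residue : Module.length R (ResidueField R →ₗ[R] R) = socdim R := by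
  rw [socdim, moduleLength_eq]
  let q : R →ₗ[R] ResidueField R := (maximalIdeal R).mkQ
  have hq : Function.Surjective q := (maximalIdeal R).mkQ_surjective
  let f : (ResidueField R →ₗ[R] R) →ₗ[R] R :=
    { toFun := fun g => g (q 1), map_add' := fun _ _ => rfl, map_smul' := fun _ _ => rfl }
  have hfi : Function.Injective f := by
    intro g h hgh
    have : g ∘ₗ q = h ∘ₗ q := LinearMap.ext_ring hgh
    exact (LinearMap.cancel_right hq).1 this
  have hr : LinearMap.range f = socle R := by
    ext x
    rw [socle, Submodule.mem_colon]
    constructor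
    · rintro ⟨g, rfl⟩ y hy
      change g (q 1) • y ∈ _
      have : q y = 0 := (Submodule.Quotient.mk_eq_zero _).2 hy
      rw [Submodule.mem_bot, smul_eq_mul, mul_comm, ← smul_eq_mul]
      change y • g (q 1) = 0
      rw [← map_smul, ← map_smul, smul_eq_mul, mul_one, this, map_zero]
    · intro h
      refine ⟨(maximalIdeal R).liftQ (LinearMap.toSpanSingleton R R x) ?_, ?_⟩
      · intro y hy
        have := h y hy
        rw [Submodule.mem_bot, smul_eq_mul, mul_comm] at this
        simpa using this
      · change (1 : R) • x = x
        simp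
  rw [← hr]
  exact (LinearEquiv.ofInjective f hfi).length_eq

/-- the kernel of `R^a → k^a` -/
noncomputable def kerPiEquiv (a : ℕ) (p0 : (Fin a → R) →ₗ[R] (Fin a → ResidueField R))
    (h0 : ∀ x i, p0 x i = residue R (x i)) :
    LinearMap.ker p0 ≃ₗ[R] (Fin a → maximalIdeal R) where
  toFun x i := ⟨x.1 i, by
    have := congrFun x.2 i
    rw [h0] at this
    exact (residue_eq_zero_iff _).1 this⟩
  invFun y := ⟨fun i => (y i).1, by
    rw [LinearMap.mem_ker]
    funext i
    rw [h0]
    exact (residue_eq_zero_iff _).2 (y i).2⟩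
  map_add' _ _ := rfl
  map_smul' _ _ := rfl
  left_inv _ := rfl
  right_inv _ := rfl

end len
/-- Let `(R, m, k)` be a local ring with `m³ = 0 ≠ m²` and let `M` be a finitely
generated `R`-module with `m²M = 0` and `Ext¹_R(M, R) = 0`.  Then
`ℓ_R(Hom_R(M, R)) = r·ℓ_R(M) − dim_k(M/mM)·μ¹_R` (stated in the rearranged form
`ℓ_R(Hom_R(M, R)) + dim_k(M/mM)·μ¹_R = r·ℓ_R(M)`), where `r = dim_k(0 :_R m)` and
`μ¹_R = dim_k Ext¹_R(k, R)`. -/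
theorem length_dual (R : Type) [CommRing R] [IsNoetherianRing R] [IsLocalRing R]
    (h3 : maximalIdeal R ^ 3 = ⊥) (h2 : maximalIdeal R ^ 2 ≠ ⊥)
    (M : Type) [AddCommGroup M] [Module R M] [Module.Finite R M]
    (hM : maximalIdeal R ^ 2 • (⊤ : Submodule R M) = ⊥)
    (hext : Subsingleton (extModule R M R 1).carrier) :
    moduleLength R (M →ₗ[R] R)
        + moduleLength R (M ⧸ maximalIdeal R • (⊤ : Submodule R M)) * bassNum R 1
      = socdim R * moduleLength R M := by
  have hart : IsArtinianRing R :=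
    (isArtinianRing_iff_isNilpotent_maximalIdeal R).2 ⟨3, h3⟩
  rw [bassNum, moduleLength_eq, moduleLength_eq, moduleLength_eq, moduleLength_eq]
  set mM : Submodule R M := maximalIdeal R • (⊤ : Submodule R M) with hmM
  -- the two vector spaces
  obtain ⟨a, ⟨e⟩⟩ := exists_equiv_pi (R := R) (M ⧸ mM) (by
    intro x hx v
    obtain ⟨w, rfl⟩ := Submodule.mkQ_surjective _ v
    rw [← map_smul]
    exact (Submodule.Quotient.mk_eq_zero _).2 (Submodule.smul_mem_smul hx trivial))
  obtain ⟨b, ⟨e'⟩⟩ := exists_equiv_pi (R := R) mM (by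
    intro x hx v
    apply Subtype.ext
    have h : x • v.1 ∈ maximalIdeal R ^ 2 • (⊤ : Submodule R M) := by
      rw [pow_two, ← smul_eq_mul, Submodule.smul_assoc]
      exact Submodule.smul_mem_smul hx v.2
    rw [hM] at h
    exact h)
  have hla : Module.length R (M ⧸ mM) = a := by rw [e.length_eq, length_pi_residue]
  have hlb : Module.length R mM = b := by rw [e'.length_eq, length_pi_residue]
  have hlM : Module.length R M = b + a := by
    rw [← hla, ← hlb]
    exact Module.length_eq_add_of_exact mM.subtype mM.mkQ (Submodule.injective_subtype _)
      mM.mkQ_surjective (LinearMap.exact_subtype_mkQ mM)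
  -- the minimal cover
  let p0 : (Fin a → R) →ₗ[R] (Fin a → ResidueField R) :=
    LinearMap.pi fun i => (maximalIdeal R).mkQ ∘ₗ LinearMap.proj i
  have h0 : ∀ x i, p0 x i = residue R (x i) := fun _ _ => rfl
  have hp0 : Function.Surjective p0 := by
    intro y
    choose x hx using fun i => residue_surjective (y i)
    exact ⟨x, funext hx⟩
  obtain ⟨p, hp⟩ := Module.projective_lifting_property mM.mkQ (e.symm.toLinearMap ∘ₗ p0)
    mM.mkQ_surjective
  have hps : Function.Surjective p := by
    refine LinearMap.surjective_of_surjective_comp_mkQ p (maximalIdeal R) ?_ ?_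
    · exact (IsLocalRing.jacobson_eq_maximalIdeal ⊥ bot_ne_top).ge
    · rw [← hmM, hp]
      exact e.symm.surjective.comp hp0
  have hmem : ∀ x, x ∈ LinearMap.ker p0 ↔ p x ∈ mM := by
    intro x
    have hx : mM.mkQ (p x) = e.symm (p0 x) := LinearMap.congr_fun hp x
    rw [LinearMap.mem_ker, ← Submodule.Quotient.mk_eq_zero mM, ← Submodule.mkQ_apply, hx,
      LinearEquiv.map_eq_zero_iff]
  have hle : LinearMap.ker p ≤ LinearMap.ker p0 := by
    intro x hx
    rw [hmem, LinearMap.mem_ker.1 hx]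
    exact mM.zero_mem
  -- equation for `k`
  have hker : LinearMap.ker (Algebra.linearMap R (ResidueField R)) = maximalIdeal R := by
    ext x
    exact residue_eq_zero_iff x
  have E1 := length_hom_ext (Algebra.linearMap R (ResidueField R)) residue_surjective R
  rw [length_hom_residue, hker] at E1
  -- equation for `M`
  have E2 := length_hom_ext p hps R
  rw [Module.length_eq_zero_iff.2 hext, add_zero, length_hom_pi] at E2
  -- the sequence `0 → K → L → mM → 0`
  have E3 : a * Module.length R (maximalIdeal R →ₗ[R] R)
      = b * socdim R + Module.length R (LinearMap.ker p →ₗ[R] R) := by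
    rw [← length_hom_pi, ← length_hom_residue (R := R), ← length_hom_pi,
      ← (e'.congrLeft R R).length_eq, ← ((kerPiEquiv a p0 h0).congrLeft R R).length_eq]
    let q : LinearMap.ker p0 →ₗ[R] mM := p.restrict fun x hx => (hmem x).1 hx
    have hq : Function.Surjective q := by
      rintro ⟨y, hy⟩
      obtain ⟨x, rfl⟩ := hps y
      exact ⟨⟨x, (hmem x).2 hy⟩, rfl⟩
    have hex : Function.Exact (Submodule.inclusion hle) q := by
      intro x
      constructor
      · intro h
        exact ⟨⟨x.1, congrArg Subtype.val h⟩, rfl⟩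
      · rintro ⟨y, rfl⟩
        exact Subtype.ext y.2
    refine Module.length_eq_add_of_exact (q.lcomp R R) ((Submodule.inclusion hle).lcomp R R)
      (LinearMap.lcomp_injective_of_surjective q hq) ?_
      (LinearMap.exact_lcomp_of_exact_of_surjective R hex hq)
    intro f
    obtain ⟨δ, -, hδ⟩ := ext_param p hps R
    obtain ⟨g, hg⟩ := (hδ f).1 (Subsingleton.elim _ _)
    exact ⟨g ∘ₗ (LinearMap.ker p0).subtype, by rw [← hg]; rfl⟩
  have hfin : Module.length R (LinearMap.ker p →ₗ[R] R) ≠ ⊤ := Module.length_ne_top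
  rw [hla, hlM]
  refine ENat.add_left_injective_of_ne_top hfin ?_
  beta_reduce
  calc _ = (Module.length R (M →ₗ[R] R) + Module.length R (LinearMap.ker p →ₗ[R] R))
        + a * Module.length R (extModule R (ResidueField R) R 1).carrier := by ring
    _ = a * (socdim R + Module.length R (maximalIdeal R →ₗ[R] R)) := by
      rw [← E2, ← E1, mul_add]
    _ = _ := by rw [mul_add, E3]; ring
end
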